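/- arXiv:2503.00827 — 11 statements merged into one kernel-verified Lean document; each statement's English description precedes it below -/
import Mathlib

section
/- Suppose the regularization R satisfies R(0)=0, R(−u)=R(u) for all u ∈ X, and R(u+ũ) ≤ R(u)+R(ũ) for all u,ũ ∈ X; suppose the set {u ∈ E : R(u) < +∞} is dense in E; suppose the existence assumption holds; and suppose limsup_n 2^{βn}/λ_n < +∞. Then the multiscale sequence {σ_n}_{n≥0} satisfies lim_n d(Λ̃, Λ(σ_n)) = δ_0 = inf{ d(Λ̃, Λ(σ)) : σ ∈ E }. -/
open Filter Finset
open scoped ENNReal Topology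

/-- If `a (n + 1) ≤ a n + r n` and `r n ≤ a n`, then `r n ^ β` cannot stay below `a n ^ β` by a
fixed positive multiple of `2 ^ (β n)`: the rescaled sequence `a n / 2 ^ n` is nonincreasing, and
`r n / 2 ^ n` is asymptotically at least its limit. -/
theorem not_eventually_add_rpow_le_rpow {a r : ℕ → ℝ} {β k : ℝ} (hβ : 0 < β) (hk : 0 < k)
    (ha : ∀ n, 0 ≤ a n) (hr : ∀ n, 0 ≤ r n) (hstep : ∀ n, a (n + 1) ≤ a n + r n)
    (hle : ∀ n, r n ≤ a n) :
    ¬ ∀ᶠ n : ℕ in atTop, k * (2 : ℝ) ^ (β * (n : ℝ)) + r n ^ β ≤ a n ^ β := by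
  intro hgap
  set b : ℕ → ℝ := fun n => a n / 2 ^ n with hb
  have hb0 : ∀ n, 0 ≤ b n := fun n => by have := ha n; positivity
  have hbs : ∀ n, 2 * b (n + 1) - b n ≤ r n / 2 ^ n := by
    intro n
    have h : 2 * b (n + 1) = a (n + 1) / 2 ^ n := by
      simp only [hb, pow_succ]; field_simp
    rw [h, ← sub_nonneg]
    have : r n / 2 ^ n - (a (n + 1) / 2 ^ n - b n) = (a n + r n - a (n + 1)) / 2 ^ n := by
      simp only [hb]; ring
    rw [this]
    have := hstep n
    exact div_nonneg (by linarith) (by positivity)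
  have hanti : Antitone b := by
    refine antitone_nat_of_succ_le fun n => ?_
    have h1 := hbs n
    have h2 : r n / 2 ^ n ≤ b n := div_le_div_of_nonneg_right (hle n) (by positivity)
    linarith
  obtain ⟨l, hl⟩ : ∃ l, Tendsto b atTop (𝓝 l) :=
    ⟨_, tendsto_atTop_ciInf hanti ⟨0, by rintro _ ⟨n, rfl⟩; exact hb0 n⟩⟩
  have hl0 : 0 ≤ l := ge_of_tendsto' hl hb0
  have hpow : ∀ (x : ℝ) (n : ℕ), 0 ≤ x → (x / 2 ^ n) ^ β = x ^ β / (2 : ℝ) ^ (β * (n : ℝ)) := by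
    intro x n hx
    rw [Real.div_rpow hx (by positivity), ← Real.rpow_natCast, ← Real.rpow_mul (by norm_num),
      mul_comm β]
  have hineq : ∀ᶠ n : ℕ in atTop, k + (max 0 (2 * b (n + 1) - b n)) ^ β ≤ b n ^ β := by
    filter_upwards [hgap] with n hn
    have h1 : (max 0 (2 * b (n + 1) - b n)) ^ β ≤ (r n / 2 ^ n) ^ β :=
      Real.rpow_le_rpow (le_max_left _ _)
        (max_le (div_nonneg (hr n) (by positivity)) (hbs n)) hβ.le
    have h2 : k + (r n / 2 ^ n) ^ β ≤ b n ^ β := by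
      have hp : (0 : ℝ) < (2 : ℝ) ^ (β * (n : ℝ)) := by positivity
      simp only [hb]
      rw [hpow _ n (hr n), hpow _ n (ha n), le_div_iff₀ hp, add_mul, div_mul_cancel₀ _ hp.ne']
      exact hn
    linarith
  have hmax : Tendsto (fun n => max 0 (2 * b (n + 1) - b n)) atTop (𝓝 l) := by
    have h := (tendsto_const_nhds (x := (0 : ℝ))).max
      (((hl.comp (tendsto_add_atTop_nat 1)).const_mul 2).sub hl)
    have e : max 0 (2 * l - l) = l := by rw [two_mul, add_sub_cancel_right, max_eq_right hl0]
    rw [e] at h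
    exact h
  have hfin := le_of_tendsto_of_tendsto
    ((hmax.rpow_const (Or.inr hβ.le)).const_add k) (hl.rpow_const (Or.inr hβ.le)) hineq
  linarith

/-- A finite limsup of `2 ^ (β n) / lam n` bounds `lam n` below by a multiple of `2 ^ (β n)`. -/
theorem exists_eventually_mul_two_rpow_le {lam : ℕ → ℝ} {β : ℝ} (hlam : ∀ n, 0 < lam n)
    (hlimsup :
      Filter.limsup (fun n : ℕ => ENNReal.ofReal ((2 : ℝ) ^ (β * (n : ℝ)) / lam n))
        Filter.atTop < ⊤) :
    ∃ k : ℝ, 0 < k ∧ ∀ᶠ n : ℕ in atTop, k * (2 : ℝ) ^ (β * (n : ℝ)) ≤ lam n := by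
  obtain ⟨M, hM, hMtop⟩ := exists_between hlimsup
  have hev := eventually_lt_of_limsup_lt hM
  have hMpos : 0 < M.toReal := ENNReal.toReal_pos (bot_le.trans_lt hM).ne' hMtop.ne
  refine ⟨M.toReal⁻¹, inv_pos.2 hMpos, ?_⟩
  filter_upwards [hev] with n hn
  have h1 := (ENNReal.ofReal_le_iff_le_toReal hMtop.ne).1 hn.le
  rw [div_le_iff₀ (hlam n)] at h1
  rwa [inv_mul_le_iff₀ hMpos]

/-- convergence in the measurements space, Theorem 2.1 of M-N-R.
If the regularization `R` satisfies `R 0 = 0`, symmetry and subadditivity, the set of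
admissible unknowns with finite regularization is dense in `E`, the existence assumption
for the minimization problems holds, and `limsup 2^(β n) / λ_n < ∞`, then the multiscale
sequence `σ_n = ∑_{j=0}^n u_j` satisfies
`lim_n d(Λ̃, Λ(σ_n)) = δ_0 = inf { d(Λ̃, Λ σ) : σ ∈ E }`. -/
theorem statement0
    {X : Type*} [NormedAddCommGroup X] [NormedSpace ℝ X] [CompleteSpace X]
    {Y : Type*} [MetricSpace Y]
    (E : Set X) (hEclosed : IsClosed E) (hEne : E.Nonempty)
    (Λ : X → Y) (Λt : Y)
    (hcont : ContinuousOn (fun σ => dist Λt (Λ σ)) E)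
    (R : X → ℝ≥0∞) (α β : ℝ) (hα : 0 < α) (hβ : 0 < β)
    (hR0 : R 0 = 0) (hRsymm : ∀ u : X, R (-u) = R u)
    (hRsub : ∀ u v : X, R (u + v) ≤ R u + R v)
    (hdense : E ⊆ closure {u : X | u ∈ E ∧ R u < ⊤})
    (lam : ℕ → ℝ) (hlam : ∀ n, 0 < lam n)
    (hexist : ∀ base : X, (base = 0 ∨ base ∈ E) → ∀ l : ℝ, 0 < l →
      ∃ u : X, base + u ∈ E ∧ ∀ w : X, base + w ∈ E →
        ENNReal.ofReal (l * dist Λt (Λ (base + u)) ^ α) + R u ^ β ≤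
          ENNReal.ofReal (l * dist Λt (Λ (base + w)) ^ α) + R w ^ β)
    (hlimsup :
      Filter.limsup (fun n : ℕ => ENNReal.ofReal ((2 : ℝ) ^ (β * (n : ℝ)) / lam n))
        Filter.atTop < ⊤)
    (u : ℕ → X)
    (hmin : ∀ n : ℕ,
      (∑ j ∈ Finset.range n, u j) + u n ∈ E ∧
      ∀ w : X, (∑ j ∈ Finset.range n, u j) + w ∈ E →
        ENNReal.ofReal (lam n *
            dist Λt (Λ ((∑ j ∈ Finset.range n, u j) + u n)) ^ α) + R (u n) ^ β ≤
          ENNReal.ofReal (lam n *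
            dist Λt (Λ ((∑ j ∈ Finset.range n, u j) + w)) ^ α) + R w ^ β) :
    Tendsto (fun n : ℕ => dist Λt (Λ (∑ j ∈ Finset.range (n + 1), u j))) atTop
      (𝓝 (sInf ((fun σ => dist Λt (Λ σ)) '' E))) := by
  have hsucc : ∀ n, (∑ j ∈ Finset.range n, u j) + u n = ∑ j ∈ Finset.range (n + 1), u j :=
    fun n => (Finset.sum_range_succ u n).symm
  simp only [hsucc] at hmin
  set S : ℕ → X := fun n => ∑ j ∈ Finset.range n, u j with hS
  set d : X → ℝ := fun σ => dist Λt (Λ σ) with hd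
  have hSsucc : ∀ n, S (n + 1) = S n + u n := fun n => Finset.sum_range_succ u n
  have hd0 : ∀ σ, 0 ≤ d σ := fun σ => dist_nonneg
  have hSE : ∀ n, S (n + 1) ∈ E := fun n => (hmin n).1
  have hbdd : BddBelow (d '' E) := ⟨0, by rintro _ ⟨σ, _, rfl⟩; exact hd0 σ⟩
  have hanti : Antitone fun n => d (S (n + 1)) := by
    refine antitone_nat_of_succ_le fun n => ?_
    have h := (hmin (n + 1)).2 0 (by simpa using hSE n)
    rw [hR0, ENNReal.zero_rpow_of_pos hβ, add_zero, add_zero] at h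
    have h' := (ENNReal.ofReal_le_ofReal_iff
      (mul_nonneg (hlam _).le (Real.rpow_nonneg (hd0 _) _))).1 (le_self_add.trans h)
    exact (Real.rpow_le_rpow_iff (hd0 _) (hd0 _) hα).1 (le_of_mul_le_mul_left h' (hlam _))
  refine tendsto_order.2 ⟨fun m hm => Eventually.of_forall fun n =>
    hm.trans_le (csInf_le hbdd ⟨_, hSE n, rfl⟩), fun m hm => ?_⟩
  suffices h : ∃ n, d (S (n + 1)) < m by
    obtain ⟨n, hn⟩ := h
    filter_upwards [eventually_ge_atTop n] with p hp
    exact (hanti hp).trans_lt hn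
  by_contra! hge
  obtain ⟨τ, ⟨hτE, hτR⟩, hτd⟩ : ∃ τ, (τ ∈ E ∧ R τ < ⊤) ∧ d τ < m := by
    obtain ⟨_, ⟨σ, hσE, rfl⟩, hσ⟩ := exists_lt_of_csInf_lt (hEne.image d) hm
    have hnhds : ∀ᶠ τ in 𝓝 σ, τ ∈ E → d τ < m :=
      eventually_nhdsWithin_iff.1 ((hcont σ hσE).eventually_lt_const hσ)
    obtain ⟨τ, hτ, hlt⟩ :=
      ((mem_closure_iff_frequently.1 (hdense hσE)).and_eventually hnhds).exists
    exact ⟨τ, hτ, hlt hτ.1⟩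
  have hc : 0 < m ^ α - d τ ^ α := sub_pos.2 (Real.rpow_lt_rpow (hd0 _) hτd hα)
  have hm0 : 0 ≤ m := (hd0 τ).trans hτd.le
  have hcomp : ∀ n, ENNReal.ofReal (lam n * (m ^ α - d τ ^ α)) + R (u n) ^ β
      ≤ R (τ - S n) ^ β := by
    intro n
    have h := (hmin n).2 (τ - S n) (by simpa [hS] using hτE)
    have e : (∑ j ∈ Finset.range n, u j) + (τ - S n) = τ := by simp [hS]
    rw [e] at h
    have hsplit : ENNReal.ofReal (lam n * d τ ^ α) +
        ENNReal.ofReal (lam n * (m ^ α - d τ ^ α)) ≤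
        ENNReal.ofReal (lam n * d (S (n + 1)) ^ α) := by
      rw [← ENNReal.ofReal_add (mul_nonneg (hlam n).le (Real.rpow_nonneg (hd0 _) _))
        (mul_nonneg (hlam n).le hc.le)]
      refine ENNReal.ofReal_le_ofReal ?_
      have := mul_le_mul_of_nonneg_left (Real.rpow_le_rpow hm0 (hge n) hα.le) (hlam n).le
      linarith
    refine (ENNReal.add_le_add_iff_left
      (ENNReal.ofReal_ne_top (r := lam n * d τ ^ α))).1 ?_
    rw [← add_assoc]
    exact (add_le_add_left hsplit _).trans h
  have hRle : ∀ n, R (u n) ≤ R (τ - S n) := fun n =>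
    (ENNReal.rpow_le_rpow_iff hβ).1 (le_add_self.trans (hcomp n))
  have hRstep : ∀ n, R (τ - S (n + 1)) ≤ R (τ - S n) + R (u n) := by
    intro n
    have e : τ - S (n + 1) = (τ - S n) + -u n := by rw [hSsucc]; abel
    rw [e, ← hRsymm (u n)]
    exact hRsub _ _
  have hfin : ∀ n, R (τ - S n) ≠ ⊤ := by
    intro n
    induction n with
    | zero => simpa [hS] using hτR.ne
    | succ n ih =>
      exact ne_top_of_le_ne_top
        (ENNReal.add_ne_top.2 ⟨ih, ne_top_of_le_ne_top ih (hRle n)⟩) (hRstep n)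
  have hufin : ∀ n, R (u n) ≠ ⊤ := fun n => ne_top_of_le_ne_top (hfin n) (hRle n)
  obtain ⟨k, hk, hkev⟩ := exists_eventually_mul_two_rpow_le hlam hlimsup
  refine not_eventually_add_rpow_le_rpow (a := fun n => (R (τ - S n)).toReal)
    (r := fun n => (R (u n)).toReal) hβ (mul_pos hc hk)
    (fun n => ENNReal.toReal_nonneg) (fun n => ENNReal.toReal_nonneg) (fun n => ?_)
    (fun n => ENNReal.toReal_mono (hfin n) (hRle n)) ?_
  · rw [← ENNReal.toReal_add (hfin n) (hufin n)]
    exact ENNReal.toReal_mono (ENNReal.add_ne_top.2 ⟨hfin n, hufin n⟩) (hRstep n)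
  · filter_upwards [hkev] with n hn
    have h := ENNReal.toReal_mono (ENNReal.rpow_ne_top_of_nonneg hβ.le (hfin n)) (hcomp n)
    rw [ENNReal.toReal_add ENNReal.ofReal_ne_top
      (ENNReal.rpow_ne_top_of_nonneg hβ.le (hufin n)),
      ENNReal.toReal_ofReal (mul_nonneg (hlam n).le hc.le),
      ← ENNReal.toReal_rpow, ← ENNReal.toReal_rpow] at h
    have := mul_le_mul_of_nonneg_left hn hc.le
    linarith
end

section
/- Assume R is convex on X and that u_0 is a solution of the minimization problem min{ λ_0‖f−Λ(u)‖_H² + R(u) : u ∈ X }. Then u ∈ X is also a solution of this problem if and only if Λ(u−u_0)=0 and R(u)=R(u_0). Consequently, if Λ is injective on Ẽ = {u ∈ X : R(u) < +∞}, or if R satisfies the strict convexity condition (for any u ≠ ũ in X with R(u)=R(ũ)<+∞ one has R(u+t(ũ−u)) < R(u) for all t ∈ (0,1)), then the solution is unique. -/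
open scoped ENNReal

/-- Two minimizers of `lam ‖f - Λ u‖² + R u`, with `R` convex and proper, have the same image
under `Λ` and the same value of `R`. -/
theorem map_eq_and_penalty_eq_of_minimizers
    {X H : Type*} [AddCommGroup X] [Module ℝ X]
    [NormedAddCommGroup H] [InnerProductSpace ℝ H]
    (Λ : X →ₗ[ℝ] H) (R : X → ℝ≥0∞) {x : X} (hx : R x < ⊤)
    (hconv : ∀ u v : X, ∀ t : ℝ, 0 ≤ t → t ≤ 1 →
      R ((1 - t) • u + t • v) ≤ ENNReal.ofReal (1 - t) * R u + ENNReal.ofReal t * R v)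
    {lam : ℝ} (hlam : 0 < lam) (f : H) {u v : X}
    (hu : ∀ w : X, ENNReal.ofReal (lam * ‖f - Λ u‖ ^ 2) + R u ≤
      ENNReal.ofReal (lam * ‖f - Λ w‖ ^ 2) + R w)
    (hv : ∀ w : X, ENNReal.ofReal (lam * ‖f - Λ v‖ ^ 2) + R v ≤
      ENNReal.ofReal (lam * ‖f - Λ w‖ ^ 2) + R w) :
    Λ u = Λ v ∧ R u = R v := by
  have finite_of_le {w : X} (hw : ENNReal.ofReal (lam * ‖f - Λ w‖ ^ 2) + R w ≤
      ENNReal.ofReal (lam * ‖f - Λ x‖ ^ 2) + R x) : R w ≠ ⊤ :=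
    ((le_add_self.trans hw).trans_lt (ENNReal.add_lt_top.2 ⟨ENNReal.ofReal_lt_top, hx⟩)).ne
  have hRu := finite_of_le (hu x)
  have hRv := finite_of_le (hv x)
  have toReal_le {y z : X} (hy : R y ≠ ⊤) (hz : R z ≠ ⊤)
      (h : ENNReal.ofReal (lam * ‖f - Λ y‖ ^ 2) + R y ≤
        ENNReal.ofReal (lam * ‖f - Λ z‖ ^ 2) + R z) :
      lam * ‖f - Λ y‖ ^ 2 + (R y).toReal ≤ lam * ‖f - Λ z‖ ^ 2 + (R z).toReal := by
    have h' := ENNReal.toReal_mono (ENNReal.add_ne_top.2 ⟨ENNReal.ofReal_ne_top, hz⟩) h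
    rwa [ENNReal.toReal_add ENNReal.ofReal_ne_top hy,
      ENNReal.toReal_add ENNReal.ofReal_ne_top hz, ENNReal.toReal_ofReal (by positivity),
      ENNReal.toReal_ofReal (by positivity)] at h'
  set m : X := (1 - (1 / 2 : ℝ)) • u + (1 / 2 : ℝ) • v with hm
  have hmid := hconv u v (1 / 2) (by norm_num) (by norm_num)
  rw [← hm] at hmid
  have hA : ENNReal.ofReal (1 - 1 / 2) * R u ≠ ⊤ := ENNReal.mul_ne_top ENNReal.ofReal_ne_top hRu
  have hB : ENNReal.ofReal (1 / 2) * R v ≠ ⊤ := ENNReal.mul_ne_top ENNReal.ofReal_ne_top hRv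
  have hsum := ENNReal.add_ne_top.2 ⟨hA, hB⟩
  have hRm : R m ≠ ⊤ := ne_top_of_le_ne_top hsum hmid
  have hmid' := ENNReal.toReal_mono hsum hmid
  rw [ENNReal.toReal_add hA hB, ENNReal.toReal_mul, ENNReal.toReal_mul,
    ENNReal.toReal_ofReal (by norm_num), ENNReal.toReal_ofReal (by norm_num)] at hmid'
  have hum := toReal_le hRu hRm (hu m)
  have hvm := toReal_le hRv hRm (hv m)
  have hfm : f - Λ m = (1 / 2 : ℝ) • ((f - Λ u) + (f - Λ v)) := by
    rw [hm, map_add, map_smul, map_smul]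
    module
  have hpar := parallelogram_law_with_norm ℝ (f - Λ u) (f - Λ v)
  rw [sub_sub_sub_cancel_left] at hpar
  have hnorm : ‖f - Λ m‖ ^ 2 = (‖f - Λ u‖ ^ 2 + ‖f - Λ v‖ ^ 2) / 2 - ‖Λ v - Λ u‖ ^ 2 / 4 := by
    rw [hfm, norm_smul, mul_pow, Real.norm_of_nonneg (by norm_num)]
    linarith
  rw [hnorm] at hum hvm
  have hzero : ‖Λ v - Λ u‖ ^ 2 = 0 := by
    have : lam * ‖Λ v - Λ u‖ ^ 2 ≤ 0 := by linarith
    exact le_antisymm (nonpos_of_mul_nonpos_right this hlam) (sq_nonneg _)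
  have hΛ : Λ u = Λ v :=
    (sub_eq_zero.1 (norm_eq_zero.1 ((pow_eq_zero_iff two_ne_zero).1 hzero))).symm
  have huv := le_antisymm (hu v) (hv u)
  rw [hΛ] at huv
  exact ⟨hΛ, (ENNReal.add_right_inj ENNReal.ofReal_ne_top).1 huv⟩


/-- uniqueness remark in the linear case.
If `R` is convex and `u₀` solves `min λ₀‖f − Λ u‖² + R u`, then `u` is also a solution
iff `Λ(u − u₀) = 0` and `R u = R u₀`; consequently, if `Λ` is injective on
`Ẽ = {u : R u < ∞}`, or if `R` is strictly convex, the solution is unique. -/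
theorem statement1
    {X H : Type*} [NormedAddCommGroup X] [NormedSpace ℝ X] [CompleteSpace X]
    [NormedAddCommGroup H] [InnerProductSpace ℝ H] [CompleteSpace H]
    (Λ : X →L[ℝ] H) (R : X → ℝ≥0∞) (hR0 : R 0 < ⊤)
    (hRconv : ∀ u v : X, ∀ t : ℝ, 0 ≤ t → t ≤ 1 →
      R ((1 - t) • u + t • v) ≤ ENNReal.ofReal (1 - t) * R u + ENNReal.ofReal t * R v)
    (lam0 : ℝ) (hlam0 : 0 < lam0) (f : H)
    (u0 : X)
    (hu0 : ∀ w : X, ENNReal.ofReal (lam0 * ‖f - Λ u0‖ ^ 2) + R u0 ≤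
      ENNReal.ofReal (lam0 * ‖f - Λ w‖ ^ 2) + R w) :
    (∀ u : X,
      (∀ w : X, ENNReal.ofReal (lam0 * ‖f - Λ u‖ ^ 2) + R u ≤
          ENNReal.ofReal (lam0 * ‖f - Λ w‖ ^ 2) + R w) ↔
        (Λ (u - u0) = 0 ∧ R u = R u0)) ∧
    ((∀ u v : X, R u < ⊤ → R v < ⊤ → Λ u = Λ v → u = v) →
      ∀ u : X, (∀ w : X, ENNReal.ofReal (lam0 * ‖f - Λ u‖ ^ 2) + R u ≤
          ENNReal.ofReal (lam0 * ‖f - Λ w‖ ^ 2) + R w) → u = u0) ∧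
    ((∀ u v : X, u ≠ v → R u = R v → R v < ⊤ → ∀ t : ℝ, 0 < t → t < 1 →
        R (u + t • (v - u)) < R u) →
      ∀ u : X, (∀ w : X, ENNReal.ofReal (lam0 * ‖f - Λ u‖ ^ 2) + R u ≤
          ENNReal.ofReal (lam0 * ‖f - Λ w‖ ^ 2) + R w) → u = u0) := by
  have key (u : X) (hu : ∀ w : X, ENNReal.ofReal (lam0 * ‖f - Λ u‖ ^ 2) + R u ≤
      ENNReal.ofReal (lam0 * ‖f - Λ w‖ ^ 2) + R w) : Λ u = Λ u0 ∧ R u = R u0 :=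
    map_eq_and_penalty_eq_of_minimizers (Λ : X →ₗ[ℝ] H) R hR0 hRconv hlam0 f hu hu0
  have hfin : R u0 < ⊤ := (le_add_self.trans (hu0 0)).trans_lt
    (ENNReal.add_lt_top.2 ⟨ENNReal.ofReal_lt_top, hR0⟩)
  refine ⟨fun u => ⟨fun hu => ?_, fun ⟨hΛ, hR⟩ w => ?_⟩, fun hinj u hu => ?_,
    fun hstrict u hu => ?_⟩
  · obtain ⟨hΛ, hR⟩ := key u hu
    exact ⟨by rw [map_sub, hΛ, sub_self], hR⟩
  · rw [map_sub, sub_eq_zero] at hΛ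
    rw [hΛ, hR]
    exact hu0 w
  · obtain ⟨hΛ, hR⟩ := key u hu
    exact hinj u u0 (hR ▸ hfin) hfin hΛ
  · obtain ⟨hΛ, hR⟩ := key u hu
    by_contra hne
    have hlt := hstrict u u0 hne hR hfin (1 / 2) (by norm_num) (by norm_num)
    have hle := hu (u + (1 / 2 : ℝ) • (u0 - u))
    have hΛm : Λ (u + (1 / 2 : ℝ) • (u0 - u)) = Λ u := by
      rw [map_add, map_smul, map_sub, hΛ, sub_self, smul_zero, add_zero]
    rw [hΛm] at hle
    exact hlt.not_ge ((ENNReal.add_le_add_iff_left ENNReal.ofReal_ne_top).1 hle)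
end

section
/- Let u_0 be a solution of min{ λ_0‖f−Λ(u)‖_H² + R(u) : u ∈ X } and set v_0 = f − Λ(u_0). Then ⟨v_0, Λ(u_0)⟩_H = R(u_0)/(2λ_0), and consequently ‖f‖_H² = ‖Λ(u_0)‖_H² + ‖v_0‖_H² + R(u_0)/λ_0. -/
open scoped ENNReal

/-- A quadratic `d * t + c * t ^ 2` with `0 ≤ c` that is nonnegative for `-1 ≤ t` has `d = 0`. -/
theorem eq_zero_of_forall_neg_one_le_quadratic_nonneg {c d : ℝ} (hc : 0 ≤ c)
    (h : ∀ t : ℝ, -1 ≤ t → 0 ≤ d * t + c * t ^ 2) : d = 0 := by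
  have hM : 0 < c + |d| + 1 := by positivity
  have ht : -1 ≤ -d / (c + |d| + 1) := by
    rw [le_div_iff₀ hM]
    linarith [le_abs_self d]
  have h1 := h _ ht
  have h2 : d * (-d / (c + |d| + 1)) + c * (-d / (c + |d| + 1)) ^ 2 =
      -(d ^ 2 * (|d| + 1)) / (c + |d| + 1) ^ 2 := by
    field_simp
    ring
  rw [h2, le_div_iff₀ (by positivity), zero_mul] at h1
  have h3 : d ^ 2 ≤ 0 := by nlinarith [sq_nonneg d, mul_nonneg (sq_nonneg d) (abs_nonneg d)]
  exact pow_eq_zero_iff two_ne_zero |>.mp (le_antisymm h3 (sq_nonneg d))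

/-- first step of the Parseval-like identity.
If `u₀` solves `min λ₀‖f − Λ u‖² + R u` and `v₀ = f − Λ u₀`, then
`⟨v₀, Λ u₀⟩ = R(u₀)/(2λ₀)` and `‖f‖² = ‖Λ u₀‖² + ‖v₀‖² + R(u₀)/λ₀`. -/
theorem statement2
    {X H : Type*} [NormedAddCommGroup X] [NormedSpace ℝ X] [CompleteSpace X]
    [NormedAddCommGroup H] [InnerProductSpace ℝ H] [CompleteSpace H]
    (Λ : X →L[ℝ] H) (R : X → ℝ≥0∞) (hR0 : R 0 < ⊤)
    (hEsub : ∀ u v : X, R u < ⊤ → R v < ⊤ → R (u + v) < ⊤)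
    (hhom : ∀ u : X, R u < ⊤ → ∀ a : ℝ, R (a • u) = ENNReal.ofReal |a| * R u)
    (lam0 : ℝ) (hlam0 : 0 < lam0) (f : H) (u0 : X)
    (hu0 : ∀ w : X, ENNReal.ofReal (lam0 * ‖f - Λ u0‖ ^ 2) + R u0 ≤
      ENNReal.ofReal (lam0 * ‖f - Λ w‖ ^ 2) + R w) :
    @inner ℝ H _ (f - Λ u0) (Λ u0) = (R u0).toReal / (2 * lam0) ∧
    ‖f‖ ^ 2 = ‖Λ u0‖ ^ 2 + ‖f - Λ u0‖ ^ 2 + (R u0).toReal / lam0 := by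
  have hfin : R u0 ≠ ⊤ := fun h => by
    have h0 := hu0 0
    rw [h, add_top, top_le_iff, ENNReal.add_eq_top] at h0
    exact h0.elim ENNReal.ofReal_ne_top hR0.ne
  have hvar : ∀ t : ℝ, -1 ≤ t → 0 ≤
      ((R u0).toReal - 2 * lam0 * @inner ℝ H _ (f - Λ u0) (Λ u0)) * t +
        (lam0 * ‖Λ u0‖ ^ 2) * t ^ 2 := by
    intro t ht
    have h := hu0 ((1 + t) • u0)
    rw [hhom u0 hfin.lt_top, abs_of_nonneg (by linarith)] at h
    have h' := ENNReal.toReal_mono (by finiteness) h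
    rw [ENNReal.toReal_add (by finiteness) hfin,
      ENNReal.toReal_add (by finiteness) (by finiteness), ENNReal.toReal_mul,
      ENNReal.toReal_ofReal (by positivity), ENNReal.toReal_ofReal (by positivity),
      ENNReal.toReal_ofReal (by linarith)] at h'
    have hw : f - Λ ((1 + t) • u0) = (f - Λ u0) - t • Λ u0 := by
      rw [map_smul, add_smul, one_smul]
      abel
    rw [hw, norm_sub_sq_real (f - Λ u0), inner_smul_right, norm_smul, mul_pow, Real.norm_eq_abs,
      sq_abs] at h'
    linarith
  have hd := eq_zero_of_forall_neg_one_le_quadratic_nonneg (by positivity) hvar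
  have hinner : @inner ℝ H _ (f - Λ u0) (Λ u0) = (R u0).toReal / (2 * lam0) := by
    rw [eq_div_iff (by positivity)]
    linarith
  refine ⟨hinner, ?_⟩
  have hf := norm_add_sq_real (f - Λ u0) (Λ u0)
  rw [sub_add_cancel, hinner] at hf
  rw [hf]
  field_simp
  ring
end

section
/- Assume that for every f ∈ H and every λ > 0 the problem min{ λ‖f−Λ(u)‖_H² + R(u) : u ∈ X } admits a solution, and let {u_j}_{j≥0}, {v_j}_{j≥0} be the multiscale iterates with parameters λ_j > 0: v_{−1} = f, u_j a minimizer of λ_j‖v_{j−1}−Λ(u)‖_H² + R(u) over u ∈ X, and v_j = v_{j−1} − Λ(u_j). Then for every n ≥ 0: f = Λ(Σ_{j=0}^n u_j) + v_n and ‖f‖_H² = Σ_{j=0}^n ( ‖Λ(u_j)‖_H² + R(u_j)/λ_j ) + ‖v_n‖_H². -/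
open Finset
open scoped ENNReal

/-- A quadratic `A s + B s²` that is nonnegative for all `s ≥ -1` has vanishing linear part. -/
theorem linear_coeff_eq_zero_of_nonneg {A B : ℝ} (hB : 0 ≤ B)
    (h : ∀ s : ℝ, -1 ≤ s → 0 ≤ A * s + B * s ^ 2) : A = 0 := by
  have hD : 0 < B + |A| + 1 := by positivity
  have hs : -1 ≤ -A / (B + |A| + 1) := by
    rw [le_div_iff₀ hD]
    linarith [le_abs_self A]
  have key := h _ hs
  have heq : A * (-A / (B + |A| + 1)) + B * (-A / (B + |A| + 1)) ^ 2 =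
      -(A ^ 2 * (|A| + 1)) / (B + |A| + 1) ^ 2 := by
    field_simp
    ring
  rw [heq, le_div_iff₀ (by positivity)] at key
  have : A ^ 2 ≤ 0 := by nlinarith [mul_nonneg (sq_nonneg A) (abs_nonneg A)]
  exact pow_eq_zero_iff two_ne_zero |>.mp (le_antisymm this (sq_nonneg A))

/-- Energy identity for one minimization step with a positively homogeneous, even regularizer. -/
theorem norm_sq_eq_of_isMinimizer
    {X H : Type*} [NormedAddCommGroup X] [NormedSpace ℝ X]
    [NormedAddCommGroup H] [InnerProductSpace ℝ H]
    (Λ : X →L[ℝ] H) (R : X → ℝ≥0∞) (hR0 : R 0 < ⊤)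
    (hhom : ∀ u : X, R u < ⊤ → ∀ a : ℝ, R (a • u) = ENNReal.ofReal |a| * R u)
    {g : H} {l : ℝ} (hl : 0 < l) {u : X}
    (hmin : ∀ w : X, ENNReal.ofReal (l * ‖g - Λ u‖ ^ 2) + R u ≤
      ENNReal.ofReal (l * ‖g - Λ w‖ ^ 2) + R w) :
    ‖g‖ ^ 2 = ‖Λ u‖ ^ 2 + (R u).toReal / l + ‖g - Λ u‖ ^ 2 := by
  have hfin : R u < ⊤ :=
    lt_of_le_of_lt (le_add_self.trans (hmin 0)) (ENNReal.add_lt_top.2 ⟨ENNReal.ofReal_lt_top, hR0⟩)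
  obtain ⟨r, hr⟩ : ∃ r, (R u).toReal = r := ⟨_, rfl⟩
  have hr0 : 0 ≤ r := hr ▸ ENNReal.toReal_nonneg
  have hRu : R u = ENNReal.ofReal r := by rw [← hr, ENNReal.ofReal_toReal hfin.ne]
  obtain ⟨z, hz⟩ : ∃ z, g - Λ u = z := ⟨_, rfl⟩
  have hexpand (s : ℝ) : ‖z - s • Λ u‖ ^ 2 =
      ‖z‖ ^ 2 - 2 * (s * inner ℝ z (Λ u)) + s ^ 2 * ‖Λ u‖ ^ 2 := by
    rw [norm_sub_sq_real, inner_smul_right, norm_smul, mul_pow, Real.norm_eq_abs, sq_abs]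
  have hcoeff : r - 2 * l * inner ℝ z (Λ u) = 0 := by
    refine linear_coeff_eq_zero_of_nonneg (B := l * ‖Λ u‖ ^ 2) (by positivity) fun s hs => ?_
    have h1s : 0 ≤ 1 + s := by linarith
    have h := hmin ((1 + s) • u)
    have hres : g - Λ ((1 + s) • u) = z - s • Λ u := by
      rw [map_smul, ← hz, add_smul, one_smul]
      abel
    rw [hhom u hfin, abs_of_nonneg h1s, hres, hz, hRu, ← ENNReal.ofReal_mul h1s,
      ← ENNReal.ofReal_add (by positivity) hr0,
      ← ENNReal.ofReal_add (by positivity) (by positivity),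
      ENNReal.ofReal_le_ofReal_iff (by positivity), hexpand] at h
    linarith
  have hdiv : r / l = 2 * inner ℝ z (Λ u) := by
    rw [div_eq_iff hl.ne']
    linarith
  rw [hr, hdiv, hz, eq_add_of_sub_eq hz, norm_add_sq_real]
  ring

/-- finite-stage decomposition identity for the multiscale procedure.
With multiscale iterates `v₋₁ = f`, `u_j` minimizing `λ_j‖v_{j−1} − Λ u‖² + R u`,
and `v_j = v_{j−1} − Λ u_j`, for every `n ≥ 0` one has
`f = Λ(∑_{j=0}^n u_j) + v_n` and
`‖f‖² = ∑_{j=0}^n (‖Λ u_j‖² + R(u_j)/λ_j) + ‖v_n‖²`. -/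
theorem statement3
    {X H : Type*} [NormedAddCommGroup X] [NormedSpace ℝ X] [CompleteSpace X]
    [NormedAddCommGroup H] [InnerProductSpace ℝ H] [CompleteSpace H]
    (Λ : X →L[ℝ] H) (R : X → ℝ≥0∞) (hR0 : R 0 < ⊤)
    (hEsub : ∀ u v : X, R u < ⊤ → R v < ⊤ → R (u + v) < ⊤)
    (hhom : ∀ u : X, R u < ⊤ → ∀ a : ℝ, R (a • u) = ENNReal.ofReal |a| * R u)
    (hexist : ∀ g : H, ∀ l : ℝ, 0 < l → ∃ u : X, ∀ w : X,
      ENNReal.ofReal (l * ‖g - Λ u‖ ^ 2) + R u ≤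
        ENNReal.ofReal (l * ‖g - Λ w‖ ^ 2) + R w)
    (f : H) (lam : ℕ → ℝ) (hlam : ∀ j, 0 < lam j)
    (u : ℕ → X) (v : ℕ → H)
    (hv : ∀ j : ℕ, v j = (if j = 0 then f else v (j - 1)) - Λ (u j))
    (hmin : ∀ j : ℕ, ∀ w : X,
      ENNReal.ofReal (lam j * ‖(if j = 0 then f else v (j - 1)) - Λ (u j)‖ ^ 2) + R (u j) ≤
        ENNReal.ofReal (lam j * ‖(if j = 0 then f else v (j - 1)) - Λ w‖ ^ 2) + R w) :
    ∀ n : ℕ,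
      f = Λ (∑ j ∈ Finset.range (n + 1), u j) + v n ∧
      ‖f‖ ^ 2 =
        (∑ j ∈ Finset.range (n + 1), (‖Λ (u j)‖ ^ 2 + (R (u j)).toReal / lam j)) +
          ‖v n‖ ^ 2 := by
  have hstep (j : ℕ) := norm_sq_eq_of_isMinimizer Λ R hR0 hhom (hlam j) (hmin j)
  simp only [← hv] at hstep
  intro n
  induction n with
  | zero =>
    refine ⟨?_, by simpa using hstep 0⟩
    simp [hv 0]
  | succ n ih =>
    have hvn := hv (n + 1)
    have hn := hstep (n + 1)
    simp only [Nat.add_eq_zero_iff, one_ne_zero, and_false, if_false, Nat.add_sub_cancel] at hvn hn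
    rw [sum_range_succ u, sum_range_succ _ (n + 1), map_add]
    refine ⟨?_, by rw [ih.2, hn]; ring⟩
    rw [hvn]
    nth_rw 1 [ih.1]
    abel
end

section
/- Let f ∈ H and let u_0 ∈ F ∩ X. Then u_0 is a minimizer of min{ λ_0‖f−Λ(u)‖_H² + R(u) : u ∈ X } if and only if, setting v_0 = f − Λ(u_0), one has ‖v_0*∘Λ‖_* ≤ 1/(2λ_0) and ⟨v_0, Λ(u_0)⟩_H = ‖u_0‖_F/(2λ_0). -/
open scoped ENNReal

theorem le_of_forall_le_mul_add {a b c : ℝ} (hb : 0 ≤ b)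
    (h : ∀ t : ℝ, 0 < t → t ≤ 1 → a ≤ t * b + c) : a ≤ c := by
  by_contra! hac
  have hd : 0 < a - c := sub_pos.2 hac
  have hden : 0 < b + (a - c) := by linarith
  have ht := h ((a - c) / (2 * (b + (a - c)))) (by positivity)
    ((div_le_one (by positivity)).2 (by linarith))
  have hlt : (a - c) / (2 * (b + (a - c))) * b < a - c := by
    rw [div_mul_eq_mul_div, div_lt_iff₀ (by positivity)]
    exact mul_lt_mul_of_pos_left (by linarith) hd
  linarith

/-- First-order optimality of `w0` for `lam * ‖f - A w‖ ^ 2 + ‖w‖` in a direction `d` along which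
the norm grows at most at rate `c`. -/
theorem two_mul_inner_le_of_isMin {H F : Type*}
    [NormedAddCommGroup H] [InnerProductSpace ℝ H] [NormedAddCommGroup F] [NormedSpace ℝ F]
    (A : F →ₗ[ℝ] H) {lam : ℝ} (hlam : 0 < lam) {f : H} {w0 : F}
    (h : ∀ w : F, lam * ‖f - A w0‖ ^ 2 + ‖w0‖ ≤ lam * ‖f - A w‖ ^ 2 + ‖w‖) {d : F} {c : ℝ}
    (hd : ∀ t : ℝ, 0 < t → t ≤ 1 → ‖w0 + t • d‖ ≤ ‖w0‖ + t * c) :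
    2 * lam * inner ℝ (f - A w0) (A d) ≤ c := by
  refine le_of_forall_le_mul_add (b := lam * ‖A d‖ ^ 2) (by positivity) fun t ht ht1 => ?_
  have hmin := h (w0 + t • d)
  have hnorm := hd t ht ht1
  have hsub : f - A (w0 + t • d) = (f - A w0) - t • A d := by
    rw [map_add, map_smul, sub_sub]
  rw [hsub, norm_sub_sq_real (f - A w0), inner_smul_right, norm_smul, Real.norm_eq_abs, mul_pow,
    sq_abs] at hmin
  refine le_of_mul_le_mul_left ?_ ht
  linarith

/-- Optimality conditions for `lam * ‖f - A w‖ ^ 2 + ‖w‖`. -/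
theorem isMin_norm_sq_add_norm_iff {H F : Type*}
    [NormedAddCommGroup H] [InnerProductSpace ℝ H] [NormedAddCommGroup F] [NormedSpace ℝ F]
    (A : F →ₗ[ℝ] H) {lam : ℝ} (hlam : 0 < lam) (f : H) (w0 : F) :
    (∀ w : F, lam * ‖f - A w0‖ ^ 2 + ‖w0‖ ≤ lam * ‖f - A w‖ ^ 2 + ‖w‖) ↔
      (∀ w : F, 2 * lam * inner ℝ (f - A w0) (A w) ≤ ‖w‖) ∧
        2 * lam * inner ℝ (f - A w0) (A w0) = ‖w0‖ := by
  constructor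
  · intro h
    have hle : ∀ w : F, 2 * lam * inner ℝ (f - A w0) (A w) ≤ ‖w‖ := fun w =>
      two_mul_inner_le_of_isMin A hlam h fun t ht _ => by
        simpa [norm_smul, abs_of_pos ht] using norm_add_le w0 (t • w)
    refine ⟨hle, le_antisymm (hle w0) ?_⟩
    have hneg : 2 * lam * inner ℝ (f - A w0) (A (-w0)) ≤ -‖w0‖ :=
      two_mul_inner_le_of_isMin A hlam h fun t _ ht1 => by
        have hsmul : w0 + t • -w0 = (1 - t) • w0 := by module
        rw [hsmul, norm_smul, Real.norm_eq_abs, abs_of_nonneg (sub_nonneg.2 ht1)]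
        linarith
    rw [map_neg, inner_neg_right] at hneg
    linarith
  · rintro ⟨hle, heq⟩ w
    have hw := hle w
    have hsub : f - A w = (f - A w0) - (A w - A w0) := by abel
    have hsq : 0 ≤ lam * ‖A w - A w0‖ ^ 2 := by positivity
    rw [hsub, norm_sub_sq_real (f - A w0), inner_sub_right]
    linarith

/-- characterization of minimizers, part a.
With the Banach norm regularization `R` given by the norm of `F` (embedded in `X` via the
injective linear map `ι`), `u₀ = ι w₀ ∈ F ∩ X` is a minimizer of
`min λ₀‖f − Λ u‖² + R u` iff, with `v₀ = f − Λ u₀`,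
`‖v₀* ∘ Λ‖_* ≤ 1/(2λ₀)` (i.e. `⟨v₀, Λ(ι w)⟩ ≤ ‖w‖/(2λ₀)` for all `w ∈ F`) and
`⟨v₀, Λ u₀⟩ = ‖w₀‖_F/(2λ₀)`. -/
theorem statement5
    {X H F : Type*} [NormedAddCommGroup X] [NormedSpace ℝ X] [CompleteSpace X]
    [NormedAddCommGroup H] [InnerProductSpace ℝ H] [CompleteSpace H]
    [NormedAddCommGroup F] [NormedSpace ℝ F] [CompleteSpace F]
    (ι : F →ₗ[ℝ] X) (hι : Function.Injective ι)
    (hFne : ∃ w : F, w ≠ 0)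
    (R : X → ℝ≥0∞)
    (hR1 : ∀ w : F, R (ι w) = ENNReal.ofReal ‖w‖)
    (hR2 : ∀ u : X, u ∉ Set.range ι → R u = ⊤)
    (Λ : X →L[ℝ] H) (lam0 : ℝ) (hlam0 : 0 < lam0) (f : H) (w0 : F) :
    (∀ u : X, ENNReal.ofReal (lam0 * ‖f - Λ (ι w0)‖ ^ 2) + R (ι w0) ≤
        ENNReal.ofReal (lam0 * ‖f - Λ u‖ ^ 2) + R u) ↔
      ((∀ w : F, @inner ℝ H _ (f - Λ (ι w0)) (Λ (ι w)) ≤ (1 / (2 * lam0)) * ‖w‖) ∧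
        @inner ℝ H _ (f - Λ (ι w0)) (Λ (ι w0)) = ‖w0‖ / (2 * lam0)) := by
  have hreal : (∀ u : X, ENNReal.ofReal (lam0 * ‖f - Λ (ι w0)‖ ^ 2) + R (ι w0) ≤
        ENNReal.ofReal (lam0 * ‖f - Λ u‖ ^ 2) + R u) ↔
      ∀ w : F, lam0 * ‖f - Λ (ι w0)‖ ^ 2 + ‖w0‖ ≤ lam0 * ‖f - Λ (ι w)‖ ^ 2 + ‖w‖ := by
    have hrange : ∀ w : F, ENNReal.ofReal (lam0 * ‖f - Λ (ι w)‖ ^ 2) + R (ι w) =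
        ENNReal.ofReal (lam0 * ‖f - Λ (ι w)‖ ^ 2 + ‖w‖) := fun w => by
      rw [hR1, ENNReal.ofReal_add (by positivity) (norm_nonneg w)]
    constructor
    · intro h w
      have hw := h (ι w)
      rwa [hrange, hrange, ENNReal.ofReal_le_ofReal_iff (by positivity)] at hw
    · intro h u
      by_cases hu : u ∈ Set.range ι
      · obtain ⟨w, rfl⟩ := hu
        rw [hrange, hrange]
        exact ENNReal.ofReal_le_ofReal (h w)
      · simp [hR2 u hu]
  have hpos : 0 < 2 * lam0 := by positivity
  rw [hreal]
  refine (isMin_norm_sq_add_norm_iff (Λ.toLinearMap ∘ₗ ι) hlam0 f w0).trans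
    (and_congr (forall_congr' fun w => ?_) ?_)
  · rw [one_div_mul_eq_div, le_div_iff₀' hpos]
    rfl
  · rw [eq_div_iff hpos.ne', mul_comm _ (2 * lam0)]
    rfl
end

section
/- Let f ∈ H. Then u_0 = 0 is a minimizer of min{ λ_0‖f−Λ(u)‖_H² + R(u) : u ∈ X } if and only if f*∘Λ belongs to G and ‖f*∘Λ‖_* ≤ 1/(2λ_0). -/
open scoped ENNReal

/-- If `a ≤ t * b + c` for all `t > 0`, then `a ≤ c`. -/
theorem le_of_forall_pos_le_mul_add {a b c : ℝ} (h : ∀ t : ℝ, 0 < t → a ≤ t * b + c) :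
    a ≤ c := by
  have hlim : Filter.Tendsto (fun t : ℝ => t * b + c) (nhdsWithin 0 (Set.Ioi 0)) (nhds c) := by
    have hc : Continuous fun t : ℝ => t * b + c := by fun_prop
    simpa using (hc.tendsto 0).mono_left nhdsWithin_le_nhds
  exact ge_of_tendsto hlim (Filter.eventually_of_mem self_mem_nhdsWithin h)

/-- Comparison of the objective at `0` and at a point with image `v` and penalty `r`. -/
theorem ofReal_objective_zero_le_iff {H : Type*} [NormedAddCommGroup H] [InnerProductSpace ℝ H]
    {lam r : ℝ} (hlam : 0 ≤ lam) (hr : 0 ≤ r) (f v : H) :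
    ENNReal.ofReal (lam * ‖f‖ ^ 2) ≤ ENNReal.ofReal (lam * ‖f - v‖ ^ 2) + ENNReal.ofReal r ↔
      2 * lam * inner ℝ f v ≤ lam * ‖v‖ ^ 2 + r := by
  rw [← ENNReal.ofReal_add (by positivity) hr, ENNReal.ofReal_le_ofReal_iff (by positivity),
    norm_sub_sq_real]
  constructor <;> intro h <;> linarith

/-- characterization of minimizers, part b.
With the Banach norm regularization `R` given by the norm of `F` (embedded in `X` via the
injective linear map `ι`), `u₀ = 0` is a minimizer of `min λ₀‖f − Λ u‖² + R u` iff
`f* ∘ Λ ∈ G = F*` with `‖f* ∘ Λ‖_* ≤ 1/(2λ₀)`, i.e. iff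
`⟨f, Λ(ι w)⟩ ≤ ‖w‖/(2λ₀)` for every `w ∈ F`. -/
theorem statement6
    {X H F : Type*} [NormedAddCommGroup X] [NormedSpace ℝ X] [CompleteSpace X]
    [NormedAddCommGroup H] [InnerProductSpace ℝ H] [CompleteSpace H]
    [NormedAddCommGroup F] [NormedSpace ℝ F] [CompleteSpace F]
    (ι : F →ₗ[ℝ] X) (hι : Function.Injective ι)
    (hFne : ∃ w : F, w ≠ 0)
    (R : X → ℝ≥0∞)
    (hR1 : ∀ w : F, R (ι w) = ENNReal.ofReal ‖w‖)
    (hR2 : ∀ u : X, u ∉ Set.range ι → R u = ⊤)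
    (Λ : X →L[ℝ] H) (lam0 : ℝ) (hlam0 : 0 < lam0) (f : H) :
    (∀ u : X, ENNReal.ofReal (lam0 * ‖f - Λ (0 : X)‖ ^ 2) + R 0 ≤
        ENNReal.ofReal (lam0 * ‖f - Λ u‖ ^ 2) + R u) ↔
      (∀ w : F, @inner ℝ H _ f (Λ (ι w)) ≤ (1 / (2 * lam0)) * ‖w‖) := by
  have hR0 : R 0 = 0 := by simpa using hR1 0
  rw [hR0, map_zero, sub_zero, add_zero]
  have hscale (w : F) : inner ℝ f (Λ (ι w)) ≤ 1 / (2 * lam0) * ‖w‖ ↔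
      2 * lam0 * inner ℝ f (Λ (ι w)) ≤ ‖w‖ := by
    rw [one_div_mul_eq_div, le_div_iff₀' (by positivity)]
  constructor
  · intro h w
    rw [hscale]
    refine le_of_forall_pos_le_mul_add (b := lam0 * ‖Λ (ι w)‖ ^ 2) fun t ht => ?_
    have key := h (ι (t • w))
    rw [hR1, ofReal_objective_zero_le_iff hlam0.le (norm_nonneg _), map_smul, map_smul,
      inner_smul_right, norm_smul, norm_smul, Real.norm_of_nonneg ht.le] at key
    refine le_of_mul_le_mul_left ?_ ht
    linarith
  · intro h u
    by_cases hu : u ∈ Set.range ι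
    · obtain ⟨w, rfl⟩ := hu
      rw [hR1, ofReal_objective_zero_le_iff hlam0.le (norm_nonneg _)]
      exact ((hscale w).1 (h w)).trans (le_add_of_nonneg_left (by positivity))
    · simp [hR2 u hu]
end

section
/- Let f ∈ H be such that either f*∘Λ ∉ G or ‖f*∘Λ‖_* > 1/(2λ_0), and let u_0 be a minimizer of min{ λ_0‖f−Λ(u)‖_H² + R(u) : u ∈ X }. Then, setting v_0 = f − Λ(u_0), one has ‖v_0*∘Λ‖_* = 1/(2λ_0) and ⟨v_0, Λ(u_0)⟩_H = ‖u_0‖_F/(2λ_0) > 0. -/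
open scoped ENNReal

/-- A real number `a` with `t * a ≤ t ^ 2 * b` for all `t ∈ (0, 1)` is nonpositive. -/
lemma nonpos_of_forall_mul_le_sq_mul {a b : ℝ}
    (h : ∀ t : ℝ, 0 < t → t < 1 → t * a ≤ t ^ 2 * b) : a ≤ 0 := by
  by_contra! ha
  have hd : 0 < a + |b| + 1 := by positivity
  set t := a / (a + |b| + 1) with ht
  have ht0 : 0 < t := by positivity
  have ht1 : t < 1 := by
    rw [ht, div_lt_one hd]
    linarith [abs_nonneg b]
  have hta : t * (a + |b| + 1) = a := div_mul_cancel₀ a hd.ne'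
  have h1 : a ≤ t * b := le_of_mul_le_mul_left (by linarith [h t ht0 ht1]) ht0
  nlinarith [le_abs_self b, mul_pos ht0 ha]

section

variable {H F : Type*} [NormedAddCommGroup H] [InnerProductSpace ℝ H]
  [NormedAddCommGroup F] [NormedSpace ℝ F] {A : F →ₗ[ℝ] H} {c : ℝ} {f : H} {w₀ : F}

/-- The variational inequality at a minimizer of `w ↦ c * ‖f - A w‖ ^ 2 + ‖w‖`. -/
lemma two_mul_inner_le_of_forall_penalized_le
    (hmin : ∀ w, c * ‖f - A w₀‖ ^ 2 + ‖w₀‖ ≤ c * ‖f - A w‖ ^ 2 + ‖w‖) (h : F) (t : ℝ) :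
    t * (2 * c * inner ℝ (f - A w₀) (A h)) ≤
      t ^ 2 * (c * ‖A h‖ ^ 2) + (‖w₀ + t • h‖ - ‖w₀‖) := by
  have h1 := hmin (w₀ + t • h)
  have h2 : f - A (w₀ + t • h) = (f - A w₀) - t • A h := by
    rw [map_add, map_smul, sub_add_eq_sub_sub]
  rw [h2, norm_sub_sq_real (f - A w₀), inner_smul_right, norm_smul, mul_pow, Real.norm_eq_abs,
    sq_abs] at h1
  linarith

lemma two_mul_inner_le_norm_of_forall_penalized_le
    (hmin : ∀ w, c * ‖f - A w₀‖ ^ 2 + ‖w₀‖ ≤ c * ‖f - A w‖ ^ 2 + ‖w‖) (h : F) :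
    2 * c * inner ℝ (f - A w₀) (A h) ≤ ‖h‖ := by
  refine sub_nonpos.1 (nonpos_of_forall_mul_le_sq_mul (b := c * ‖A h‖ ^ 2) fun t ht _ ↦ ?_)
  have h1 := two_mul_inner_le_of_forall_penalized_le hmin h t
  have h2 := norm_add_le w₀ (t • h)
  rw [norm_smul, Real.norm_of_nonneg ht.le] at h2
  linarith

lemma two_mul_inner_self_eq_norm_of_forall_penalized_le
    (hmin : ∀ w, c * ‖f - A w₀‖ ^ 2 + ‖w₀‖ ≤ c * ‖f - A w‖ ^ 2 + ‖w‖) :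
    2 * c * inner ℝ (f - A w₀) (A w₀) = ‖w₀‖ := by
  refine le_antisymm (two_mul_inner_le_norm_of_forall_penalized_le hmin w₀) (sub_nonpos.1
    (nonpos_of_forall_mul_le_sq_mul (b := c * ‖A w₀‖ ^ 2) fun t _ ht ↦ ?_))
  have h1 := two_mul_inner_le_of_forall_penalized_le hmin w₀ (-t)
  have h2 : w₀ + (-t) • w₀ = (1 - t) • w₀ := by module
  rw [h2, norm_smul, Real.norm_of_nonneg (sub_nonneg.2 ht.le)] at h1
  linarith

end

/-- characterization of minimizers, part c.
With the Banach norm regularization `R` given by the norm of `F` (embedded in `X` via the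
injective linear map `ι`), if either `f* ∘ Λ ∉ G` or `‖f* ∘ Λ‖_* > 1/(2λ₀)`
(equivalently, `⟨f, Λ(ι w)⟩ ≤ ‖w‖/(2λ₀)` fails for some `w ∈ F`), and `u₀` is a
minimizer of `min λ₀‖f − Λ u‖² + R u`, then, with `v₀ = f − Λ u₀`,
`‖v₀* ∘ Λ‖_* = 1/(2λ₀)` and `⟨v₀, Λ u₀⟩ = ‖u₀‖_F/(2λ₀) > 0`. -/
theorem statement7
    {X H F : Type*} [NormedAddCommGroup X] [NormedSpace ℝ X] [CompleteSpace X]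
    [NormedAddCommGroup H] [InnerProductSpace ℝ H] [CompleteSpace H]
    [NormedAddCommGroup F] [NormedSpace ℝ F] [CompleteSpace F]
    (ι : F →ₗ[ℝ] X) (hι : Function.Injective ι)
    (hFne : ∃ w : F, w ≠ 0)
    (R : X → ℝ≥0∞)
    (hR1 : ∀ w : F, R (ι w) = ENNReal.ofReal ‖w‖)
    (hR2 : ∀ u : X, u ∉ Set.range ι → R u = ⊤)
    (Λ : X →L[ℝ] H) (lam0 : ℝ) (hlam0 : 0 < lam0) (f : H)
    (hbig : ¬ ∀ w : F, @inner ℝ H _ f (Λ (ι w)) ≤ (1 / (2 * lam0)) * ‖w‖)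
    (u0 : X)
    (hu0 : ∀ u : X, ENNReal.ofReal (lam0 * ‖f - Λ u0‖ ^ 2) + R u0 ≤
      ENNReal.ofReal (lam0 * ‖f - Λ u‖ ^ 2) + R u) :
    ∃ w0 : F, ι w0 = u0 ∧
      sSup {r : ℝ | ∃ w : F, ‖w‖ = 1 ∧ r = @inner ℝ H _ (f - Λ u0) (Λ (ι w))} =
        1 / (2 * lam0) ∧
      @inner ℝ H _ (f - Λ u0) (Λ u0) = ‖w0‖ / (2 * lam0) ∧
      0 < ‖w0‖ / (2 * lam0) := by
  have hu0_range : u0 ∈ Set.range ι := by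
    by_contra hu
    have h := hu0 (ι 0)
    rw [hR2 u0 hu, hR1, add_top, top_le_iff] at h
    exact ENNReal.add_ne_top.2 ⟨ENNReal.ofReal_ne_top, ENNReal.ofReal_ne_top⟩ h
  obtain ⟨w0, rfl⟩ := hu0_range
  let A : F →ₗ[ℝ] H := Λ.toLinearMap ∘ₗ ι
  have hmin : ∀ w, lam0 * ‖f - A w0‖ ^ 2 + ‖w0‖ ≤ lam0 * ‖f - A w‖ ^ 2 + ‖w‖ := by
    intro w
    have h := hu0 (ι w)
    rw [hR1, hR1, ← ENNReal.ofReal_add (by positivity) (by positivity),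
      ← ENNReal.ofReal_add (by positivity) (by positivity),
      ENNReal.ofReal_le_ofReal_iff (by positivity)] at h
    exact h
  have hle : ∀ w, inner ℝ (f - Λ (ι w0)) (Λ (ι w)) ≤ ‖w‖ / (2 * lam0) := by
    intro w
    rw [le_div_iff₀' (by positivity)]
    exact two_mul_inner_le_norm_of_forall_penalized_le hmin w
  have heq : inner ℝ (f - Λ (ι w0)) (Λ (ι w0)) = ‖w0‖ / (2 * lam0) := by
    rw [eq_div_iff (by positivity), mul_comm]
    exact two_mul_inner_self_eq_norm_of_forall_penalized_le hmin
  have hw0 : w0 ≠ 0 := by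
    rintro rfl
    refine hbig fun w ↦ ?_
    have h := hle w
    rw [map_zero, map_zero, sub_zero] at h
    rwa [one_div_mul_eq_div]
  have hpos : 0 < ‖w0‖ := norm_pos_iff.2 hw0
  refine ⟨w0, rfl, IsGreatest.csSup_eq ⟨⟨‖w0‖⁻¹ • w0, ?_, ?_⟩, ?_⟩, heq, by positivity⟩
  · rw [norm_smul, norm_inv, norm_norm, inv_mul_cancel₀ hpos.ne']
  · rw [map_smul, map_smul, inner_smul_right, heq]
    field_simp
  · rintro r ⟨w, hw, rfl⟩
    rw [← hw]
    exact hle w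
end

section
/- In the convex case with Hilbert norm regularization, let σ̃ ∈ S, let n ≥ 0, let u_n be a minimizer of λ_n·d(Λ̃,Λ(σ_{n−1}+u))^α + R(u)^β over {u : σ_{n−1}+u ∈ E} and σ_n = σ_{n−1}+u_n. Then ⟨σ_n − σ_{n−1}, σ̃ − σ_n⟩_{H₁} ≥ 0 and consequently ‖σ̃ − σ_n‖_{H₁} ≤ ‖σ̃ − σ_{n−1}‖_{H₁}. -/
open scoped ENNReal

/-- If `‖x‖ ≤ ‖x + t • v‖` for all `t ∈ (0, 1]`, then `⟪x, v⟫ ≥ 0`. -/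
theorem real_inner_nonneg_of_norm_le_norm_add_smul {H : Type*} [NormedAddCommGroup H]
    [InnerProductSpace ℝ H] {x v : H}
    (h : ∀ t : ℝ, 0 < t → t ≤ 1 → ‖x‖ ≤ ‖x + t • v‖) : 0 ≤ inner ℝ x v := by
  by_contra! hneg
  have key : ∀ t : ℝ, 0 < t → t ≤ 1 → 0 ≤ 2 * inner ℝ x v + t * ‖v‖ ^ 2 := by
    intro t ht ht1
    have hsq := pow_le_pow_left₀ (norm_nonneg x) (h t ht ht1) 2
    rw [norm_add_sq_real, real_inner_smul_right, norm_smul, Real.norm_of_nonneg ht.le] at hsq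
    refine nonneg_of_mul_nonneg_right (a := t) ?_ ht
    linarith
  have hpos : 0 < ‖v‖ ^ 2 + 1 := by positivity
  have ht := key (min 1 (-inner ℝ x v / (‖v‖ ^ 2 + 1)))
    (lt_min one_pos (div_pos (neg_pos.mpr hneg) hpos)) (min_le_left _ _)
  have hle : min 1 (-inner ℝ x v / (‖v‖ ^ 2 + 1)) * (‖v‖ ^ 2 + 1) ≤ -inner ℝ x v :=
    (le_div_iff₀ hpos).mp (min_le_right _ _)
  have hmin : 0 ≤ min 1 (-inner ℝ x v / (‖v‖ ^ 2 + 1)) :=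
    le_min zero_le_one (div_nonneg (neg_pos.mpr hneg).le hpos.le)
  linarith

/-- monotonicity of `H₁`-distances in the convex case with Hilbert
norm regularization.  With `R` the Hilbert norm regularization induced by the injective
linear embedding `ι : H₁ → X`, if `σ̃ = ι w̃ ∈ S`, `σ_{n−1} = ι w_{n−1}` and
`u_n = ι wₙ` is a minimizer of `λ_n d(Λ̃, Λ(σ_{n−1}+u))^α + R(u)^β` over
`{u : σ_{n−1}+u ∈ E}`, then `⟨σ_n − σ_{n−1}, σ̃ − σ_n⟩_{H₁} ≥ 0` and hence
`‖σ̃ − σ_n‖_{H₁} ≤ ‖σ̃ − σ_{n−1}‖_{H₁}`. -/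
theorem statement9
    {X Y H1 : Type*} [NormedAddCommGroup X] [NormedSpace ℝ X] [CompleteSpace X]
    [MetricSpace Y]
    [NormedAddCommGroup H1] [InnerProductSpace ℝ H1] [CompleteSpace H1]
    (E : Set X) (hEclosed : IsClosed E) (hEne : E.Nonempty) (hEconv : Convex ℝ E)
    (Λ : X → Y) (Λt : Y)
    (hcont : ContinuousOn (fun σ => dist Λt (Λ σ)) E)
    (hdconv : ConvexOn ℝ E (fun σ => dist Λt (Λ σ)))
    (ι : H1 →ₗ[ℝ] X) (hι : Function.Injective ι) (hH1ne : ∃ w : H1, w ≠ 0)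
    (R : X → ℝ≥0∞)
    (hR1 : ∀ w : H1, R (ι w) = ENNReal.ofReal ‖w‖)
    (hR2 : ∀ u : X, u ∉ Set.range ι → R u = ⊤)
    (α β : ℝ) (hα : 1 ≤ α) (hβ : 1 ≤ β)
    (σhat : X) (hσhatE : σhat ∈ E)
    (hσhatmin : ∀ σ ∈ E, dist Λt (Λ σhat) ≤ dist Λt (Λ σ))
    (hσhatR : R σhat < ⊤)
    (wt : H1) (hσtE : ι wt ∈ E)
    (hσtmin : dist Λt (Λ (ι wt)) = dist Λt (Λ σhat))
    (lamn : ℝ) (hlamn : 0 < lamn)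
    (wprev wn : H1) (hmem : ι wprev + ι wn ∈ E)
    (hminn : ∀ w : X, ι wprev + w ∈ E →
      ENNReal.ofReal (lamn * dist Λt (Λ (ι wprev + ι wn)) ^ α) + R (ι wn) ^ β ≤
        ENNReal.ofReal (lamn * dist Λt (Λ (ι wprev + w)) ^ α) + R w ^ β) :
    0 ≤ @inner ℝ H1 _ wn (wt - (wprev + wn)) ∧
    ‖wt - (wprev + wn)‖ ≤ ‖wt - wprev‖ := by
  have hinner : 0 ≤ inner ℝ wn (wt - (wprev + wn)) := by
    refine real_inner_nonneg_of_norm_le_norm_add_smul fun t ht ht1 => ?_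
    have hseg : ι wprev + ι (wn + t • (wt - (wprev + wn))) =
        (1 - t) • (ι wprev + ι wn) + t • ι wt := by
      simp only [map_add, map_sub, map_smul]
      module
    have hE : ι wprev + ι (wn + t • (wt - (wprev + wn))) ∈ E :=
      hseg ▸ hEconv hmem hσtE (sub_nonneg.mpr ht1) ht.le (by ring)
    have hd : dist Λt (Λ (ι wprev + ι (wn + t • (wt - (wprev + wn))))) ≤
        dist Λt (Λ (ι wprev + ι wn)) := by
      rw [hseg]
      have hc := hdconv.2 hmem hσtE (sub_nonneg.mpr ht1) ht.le (by ring)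
      simp only [smul_eq_mul] at hc
      have hm := mul_le_mul_of_nonneg_left (hσtmin.le.trans (hσhatmin _ hmem)) ht.le
      linarith
    have hdata := ENNReal.ofReal_le_ofReal (mul_le_mul_of_nonneg_left
      (Real.rpow_le_rpow dist_nonneg hd (zero_le_one.trans hα)) hlamn.le)
    have hreg := (ENNReal.add_le_add_iff_left ENNReal.ofReal_ne_top).mp
      ((hminn _ hE).trans (add_le_add_left hdata _))
    rw [ENNReal.rpow_le_rpow_iff (one_pos.trans_le hβ), hR1, hR1] at hreg
    exact (ENNReal.ofReal_le_ofReal_iff (norm_nonneg _)).mp hreg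
  refine ⟨hinner, (sq_le_sq₀ (norm_nonneg _) (norm_nonneg _)).mp ?_⟩
  have hsum : wt - wprev = wn + (wt - (wprev + wn)) := by abel
  rw [hsum, norm_add_sq_real]
  nlinarith [sq_nonneg ‖wn‖]
end

section
/- Let E ⊆ X be convex, let σ ↦ d(Λ̃,Λ(σ)) be a continuous convex function on E, let R be a Hilbert norm regularization satisfying the compactness condition ( {u ∈ X : R(u) ≤ b} relatively compact in X for every b ∈ ℝ ) and lower semicontinuity on X, assume there exists σ̂ ∈ E with d(Λ̃,Λ(σ̂)) = δ_0 and R(σ̂) < +∞, and let α ≥ 1, β ≥ 1. Then, with σ_{−1} = 0: (i) dist_{H₁}(σ_n, S) ≤ dist_{H₁}(σ_{n−1}, S) ≤ ‖σ̂‖_{H₁} for every n ≥ 0; (ii) if lim_n λ_n = +∞ then lim_n d(Λ̃,Λ(σ_n)) = δ_0 = min{d(Λ̃,Λ(σ)) : σ ∈ E}; (iii) if lim_n λ_n = +∞ then lim_n dist_X(σ_n, S) = 0; (iv) if lim_n λ_n = +∞ then every subsequence of {σ_n} admits a further subsequence converging in X to some σ_∞ ∈ S. -/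
open Filter Finset
open scoped ENNReal Topology

/-- If `a` has the least norm on the segment from `a` to `a + b`, then `⟪a, b⟫ ≥ 0`. -/
lemma inner_nonneg_of_norm_le_norm_add_smul {H : Type*} [NormedAddCommGroup H]
    [InnerProductSpace ℝ H] {a b : H}
    (h : ∀ t : ℝ, 0 ≤ t → t ≤ 1 → ‖a‖ ≤ ‖a + t • b‖) : 0 ≤ inner ℝ a b := by
  by_contra! hc
  set c := inner ℝ a b with hcdef
  have hB : 0 ≤ ‖b‖ ^ 2 := by positivity
  have hden : 0 < ‖b‖ ^ 2 - c := by linarith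
  set t := -c / (‖b‖ ^ 2 - c) with ht
  have ht0 : 0 < t := div_pos (by linarith) hden
  have ht1 : t ≤ 1 := by rw [ht, div_le_one hden]; linarith
  have htd : t * (‖b‖ ^ 2 - c) = -c := div_mul_cancel₀ _ hden.ne'
  have hsq := pow_le_pow_left₀ (norm_nonneg a) (h t ht0.le ht1) 2
  rw [norm_add_sq_real, real_inner_smul_right, norm_smul, mul_pow, Real.norm_eq_abs, sq_abs] at hsq
  nlinarith [mul_pos ht0 (neg_pos.2 hc), mul_pos ht0 ht0]

/-- Moving from `x` to `x + a` does not increase the distance to `p` if `a` has the least norm on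
the segment from `a` to `p - x`. -/
lemma dist_add_le_of_norm_le_segment {H : Type*} [NormedAddCommGroup H]
    [InnerProductSpace ℝ H] {x a p : H}
    (h : ∀ t : ℝ, 0 ≤ t → t ≤ 1 → ‖a‖ ≤ ‖a + t • (p - (x + a))‖) :
    dist (x + a) p ≤ dist x p := by
  have hin := inner_nonneg_of_norm_le_norm_add_smul h
  rw [dist_comm, dist_comm x, dist_eq_norm, dist_eq_norm]
  refine le_of_sq_le_sq ?_ (norm_nonneg _)
  have he : p - x = a + (p - (x + a)) := by abel
  rw [he, norm_add_sq_real]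
  nlinarith [sq_nonneg ‖a‖]

/-- Cancelling a dominated fidelity term in a comparison of Tikhonov functionals. -/
lemma norm_le_norm_of_ofReal_add_rpow_le {H : Type*} [NormedAddCommGroup H] {v w : H}
    {A B β : ℝ} (hβ : 0 < β) (hBA : B ≤ A)
    (h : ENNReal.ofReal A + ENNReal.ofReal ‖w‖ ^ β ≤
      ENNReal.ofReal B + ENNReal.ofReal ‖v‖ ^ β) : ‖w‖ ≤ ‖v‖ := by
  have h1 : ENNReal.ofReal A + ENNReal.ofReal ‖w‖ ^ β ≤
      ENNReal.ofReal A + ENNReal.ofReal ‖v‖ ^ β :=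
    h.trans (by gcongr)
  have h2 := (ENNReal.add_le_add_iff_left ENNReal.ofReal_ne_top).1 h1
  rw [ENNReal.rpow_le_rpow_iff hβ] at h2
  exact (ENNReal.ofReal_le_ofReal_iff (norm_nonneg _)).1 h2

/-- A comparison of Tikhonov functionals in `ℝ≥0∞` with finite terms, read in `ℝ`. -/
lemma add_rpow_norm_le_of_ofReal_add_rpow_le {H : Type*} [NormedAddCommGroup H] {v w : H}
    {A B β : ℝ} (hβ : 0 ≤ β) (hA : 0 ≤ A) (hB : 0 ≤ B)
    (h : ENNReal.ofReal A + ENNReal.ofReal ‖w‖ ^ β ≤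
      ENNReal.ofReal B + ENNReal.ofReal ‖v‖ ^ β) : A + ‖w‖ ^ β ≤ B + ‖v‖ ^ β := by
  rw [ENNReal.ofReal_rpow_of_nonneg (norm_nonneg _) hβ,
    ENNReal.ofReal_rpow_of_nonneg (norm_nonneg _) hβ, ← ENNReal.ofReal_add hA (by positivity),
    ← ENNReal.ofReal_add hB (by positivity)] at h
  exact (ENNReal.ofReal_le_ofReal_iff (by positivity)).1 h

/-- If `c n * a n ^ α ≤ c n * b ^ α + C` with `b ≤ a n` and `c n → ∞`, then `a n → b`. -/
lemma tendsto_of_mul_rpow_le_mul_rpow_add {a c : ℕ → ℝ} {b C α : ℝ} (hα : 0 < α) (hb : 0 ≤ b)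
    (hc : ∀ n, 0 < c n) (hba : ∀ n, b ≤ a n)
    (h : ∀ n, c n * a n ^ α ≤ c n * b ^ α + C) (hlim : Tendsto c atTop atTop) :
    Tendsto a atTop (𝓝 b) := by
  have hpow : Tendsto (fun n => a n ^ α) atTop (𝓝 (b ^ α)) := by
    have hup : Tendsto (fun n => b ^ α + C / c n) atTop (𝓝 (b ^ α)) := by
      simpa using tendsto_const_nhds.add (hlim.const_div_atTop C)
    refine tendsto_of_tendsto_of_tendsto_of_le_of_le tendsto_const_nhds hup
      (fun n => Real.rpow_le_rpow hb (hba n) hα.le) (fun n => ?_)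
    have hn := hc n
    refine le_of_mul_le_mul_left ?_ hn
    rw [mul_add, mul_div_cancel₀ _ hn.ne']
    exact h n
  have hroot := hpow.rpow_const (p := α⁻¹) (Or.inr (inv_nonneg.2 hα.le))
  rw [Real.rpow_rpow_inv hb hα.ne'] at hroot
  refine hroot.congr fun n => ?_
  exact Real.rpow_rpow_inv (hb.trans (hba n)) hα.ne'

/-- Theorem 3.1: convergence for the Hilbert norm regularization.
In the convex case with Hilbert norm regularization (via the injective embedding
`ι : H₁ → X`), compactness of sublevel sets and lower semicontinuity of `R`, and an
optimal `σ̂ = ι ŵ ∈ E` with finite regularization, the multiscale sequence satisfies: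
(i) `dist_{H₁}(σ_n, S) ≤ dist_{H₁}(σ_{n−1}, S) ≤ ‖σ̂‖_{H₁}`;
and if `λ_n → ∞`: (ii) `d(Λ̃, Λ σ_n) → δ₀`, (iii) `dist_X(σ_n, S) → 0`,
(iv) every subsequence has a further subsequence converging in `X` to some `σ∞ ∈ S`. -/
theorem statement10
    {X Y H1 : Type*} [NormedAddCommGroup X] [NormedSpace ℝ X] [CompleteSpace X]
    [MetricSpace Y]
    [NormedAddCommGroup H1] [InnerProductSpace ℝ H1] [CompleteSpace H1]
    (E : Set X) (hEclosed : IsClosed E) (hEne : E.Nonempty) (hEconv : Convex ℝ E)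
    (Λ : X → Y) (Λt : Y)
    (hcont : ContinuousOn (fun σ => dist Λt (Λ σ)) E)
    (hdconv : ConvexOn ℝ E (fun σ => dist Λt (Λ σ)))
    (ι : H1 →ₗ[ℝ] X) (hι : Function.Injective ι) (hH1ne : ∃ w : H1, w ≠ 0)
    (R : X → ℝ≥0∞)
    (hR1 : ∀ w : H1, R (ι w) = ENNReal.ofReal ‖w‖)
    (hR2 : ∀ u : X, u ∉ Set.range ι → R u = ⊤)
    (hcomp : ∀ b : ℝ, IsCompact (closure {u : X | R u ≤ ENNReal.ofReal b}))
    (hlsc : LowerSemicontinuous R)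
    (α β : ℝ) (hα : 1 ≤ α) (hβ : 1 ≤ β)
    (what : H1) (hhatE : ι what ∈ E)
    (hhatmin : ∀ σ ∈ E, dist Λt (Λ (ι what)) ≤ dist Λt (Λ σ))
    (lam : ℕ → ℝ) (hlam : ∀ n, 0 < lam n)
    (u : ℕ → X) (w : ℕ → H1) (hw : ∀ n, u n = ι (w n))
    (hmin : ∀ n : ℕ,
      (∑ j ∈ Finset.range n, u j) + u n ∈ E ∧
      ∀ v : X, (∑ j ∈ Finset.range n, u j) + v ∈ E →
        ENNReal.ofReal (lam n *
            dist Λt (Λ ((∑ j ∈ Finset.range n, u j) + u n)) ^ α) + R (u n) ^ β ≤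
          ENNReal.ofReal (lam n *
            dist Λt (Λ ((∑ j ∈ Finset.range n, u j) + v)) ^ α) + R v ^ β) :
    ∀ S : Set X,
      S = {σ : X | σ ∈ E ∧ R σ < ⊤ ∧ dist Λt (Λ σ) = dist Λt (Λ (ι what))} →
      ((∀ n : ℕ,
          Metric.infDist (∑ j ∈ Finset.range (n + 1), w j) (ι ⁻¹' S) ≤
            Metric.infDist (∑ j ∈ Finset.range n, w j) (ι ⁻¹' S) ∧
          Metric.infDist (∑ j ∈ Finset.range n, w j) (ι ⁻¹' S) ≤ ‖what‖) ∧
        (Tendsto lam atTop atTop →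
          Tendsto (fun n : ℕ => dist Λt (Λ (∑ j ∈ Finset.range (n + 1), u j))) atTop
            (𝓝 (dist Λt (Λ (ι what)))) ∧
          Tendsto (fun n : ℕ => Metric.infDist (∑ j ∈ Finset.range (n + 1), u j) S)
            atTop (𝓝 0) ∧
          ∀ φ : ℕ → ℕ, StrictMono φ → ∃ ψ : ℕ → ℕ, StrictMono ψ ∧ ∃ σinf ∈ S,
            Tendsto (fun m : ℕ => ∑ j ∈ Finset.range (φ (ψ m) + 1), u j) atTop
              (𝓝 σinf))) := by
  intro S hS
  have hβ0 : 0 < β := by linarith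
  have hα0 : 0 < α := by linarith
  have hsum : ∀ n, ∑ j ∈ Finset.range n, u j = ι (∑ j ∈ Finset.range n, w j) := fun n => by
    rw [map_sum]; exact Finset.sum_congr rfl fun j _ => hw j
  simp only [hsum]
  simp only [hw, ← map_sum, ← map_add] at hmin
  set s : ℕ → H1 := fun n => ∑ j ∈ Finset.range n, w j with hs
  have hsucc : ∀ n, s (n + 1) = s n + w n := fun n => Finset.sum_range_succ _ _
  have hs0 : s 0 = 0 := Finset.sum_range_zero _
  change ∀ n, ι (s n + w n) ∈ E ∧ ∀ v : X, ι (s n) + v ∈ E →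
    ENNReal.ofReal (lam n * dist Λt (Λ (ι (s n + w n))) ^ α) + R (ι (w n)) ^ β ≤
      ENNReal.ofReal (lam n * dist Λt (Λ (ι (s n) + v)) ^ α) + R v ^ β at hmin
  have hmin' : ∀ n, ∀ v : H1, ι (s n + v) ∈ E →
      ENNReal.ofReal (lam n * dist Λt (Λ (ι (s n + w n))) ^ α) + ENNReal.ofReal ‖w n‖ ^ β ≤
        ENNReal.ofReal (lam n * dist Λt (Λ (ι (s n + v))) ^ α) + ENNReal.ofReal ‖v‖ ^ β := by
    intro n v hv
    have h := (hmin n).2 (ι v)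
    rw [← map_add, hR1, hR1] at h
    exact h hv
  have hfejer : ∀ n, ∀ p ∈ ι ⁻¹' S, dist (s (n + 1)) p ≤ dist (s n) p := by
    intro n p hp
    rw [hS] at hp
    obtain ⟨hpE, -, hpd⟩ := hp
    rw [hsucc]
    refine dist_add_le_of_norm_le_segment fun t ht0 ht1 => ?_
    have hcomb : ι (s n + (w n + t • (p - (s n + w n)))) =
        (1 - t) • ι (s n + w n) + t • ι p := by
      rw [← map_smul, ← map_smul, ← map_add]
      congr 1
      module
    have hE := hEconv (hmin n).1 hpE (sub_nonneg.2 ht1) ht0 (sub_add_cancel 1 t)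
    have hd := hdconv.2 (hmin n).1 hpE (sub_nonneg.2 ht1) ht0 (sub_add_cancel 1 t)
    rw [← hcomb] at hE
    simp only [← hcomb, hpd, smul_eq_mul] at hd
    refine norm_le_norm_of_ofReal_add_rpow_le hβ0 ?_ (hmin' n _ hE)
    have hle := hhatmin _ (hmin n).1
    have hn := (hlam n).le
    have hdle : dist Λt (Λ (ι (s n + (w n + t • (p - (s n + w n)))))) ≤
        dist Λt (Λ (ι (s n + w n))) := by nlinarith
    gcongr
  have hwhatS : what ∈ ι ⁻¹' S := by
    rw [hS]
    exact ⟨hhatE, by rw [hR1]; exact ENNReal.ofReal_lt_top, rfl⟩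
  have hdist : ∀ n, dist (s n) what ≤ ‖what‖ := by
    intro n
    induction n with
    | zero => rw [hs0, dist_zero_left]
    | succ n ih => exact (hfejer n what hwhatS).trans ih
  refine ⟨fun n => ⟨?_, (Metric.infDist_le_dist_of_mem hwhatS).trans (hdist n)⟩, fun hlim => ?_⟩
  · exact (Metric.le_infDist ⟨what, hwhatS⟩).2 fun p hp =>
      (Metric.infDist_le_dist_of_mem hp).trans (hfejer n p hp)
  have hσE : ∀ n, ι (s (n + 1)) ∈ E := fun n => by rw [hsucc]; exact (hmin n).1
  have hd : Tendsto (fun n => dist Λt (Λ (ι (s (n + 1))))) atTop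
      (𝓝 (dist Λt (Λ (ι what)))) := by
    refine tendsto_of_mul_rpow_le_mul_rpow_add (C := ‖what‖ ^ β) hα0 dist_nonneg hlam
      (fun n => hhatmin _ (hσE n)) (fun n => ?_) hlim
    have hn := (hlam n).le
    have h := hmin' n (what - s n) (by rwa [add_sub_cancel])
    rw [add_sub_cancel] at h
    have h' := add_rpow_norm_le_of_ofReal_add_rpow_le hβ0.le (by positivity) (by positivity) h
    have hb : ‖what - s n‖ ^ β ≤ ‖what‖ ^ β := by
      refine Real.rpow_le_rpow (norm_nonneg _) ?_ hβ0.le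
      rw [← dist_eq_norm, dist_comm]
      exact hdist n
    have h0 : 0 ≤ ‖w n‖ ^ β := by positivity
    rw [hsucc]
    linarith
  have hR : ∀ n, R (ι (s n)) ≤ ENNReal.ofReal (2 * ‖what‖) := fun n => by
    rw [hR1]
    refine ENNReal.ofReal_le_ofReal ?_
    have h1 := hdist n
    rw [dist_eq_norm] at h1
    linarith [norm_le_norm_sub_add (s n) what]
  have hsub : ∀ φ : ℕ → ℕ, Tendsto φ atTop atTop → ∃ ψ : ℕ → ℕ, StrictMono ψ ∧ ∃ σinf ∈ S,
      Tendsto (fun m => ι (s (φ (ψ m) + 1))) atTop (𝓝 σinf) := by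
    intro φ hφ
    obtain ⟨σ, -, ψ, hψ, hσ⟩ := (hcomp (2 * ‖what‖)).tendsto_subseq
      (x := fun m => ι (s (φ m + 1))) fun m => subset_closure (hR _)
    have hσmem : σ ∈ E := hEclosed.mem_of_tendsto hσ (.of_forall fun m => hσE _)
    refine ⟨ψ, hψ, σ, ?_, hσ⟩
    rw [hS]
    refine ⟨hσmem, ?_, ?_⟩
    · have hmem := (hlsc.isClosed_preimage (ENNReal.ofReal (2 * ‖what‖))).mem_of_tendsto hσ
        (.of_forall fun m => hR _)
      exact lt_of_le_of_lt hmem ENNReal.ofReal_lt_top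
    · have h1 := (hcont σ hσmem).tendsto.comp
        (tendsto_nhdsWithin_iff.2 ⟨hσ, .of_forall fun m => hσE _⟩)
      exact tendsto_nhds_unique h1 (hd.comp (hφ.comp hψ.tendsto_atTop))
  refine ⟨hd, ?_, fun φ hφ => hsub φ hφ.tendsto_atTop⟩
  refine tendsto_of_subseq_tendsto fun φ hφ => ?_
  obtain ⟨ψ, -, σ, hσS, hσ⟩ := hsub φ hφ
  refine ⟨ψ, squeeze_zero (fun _ => Metric.infDist_nonneg)
    (fun _ => Metric.infDist_le_dist_of_mem hσS) (tendsto_iff_dist_tendsto_zero.1 hσ)⟩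
end

section
/- Let σ̂ ∈ H₁ with Λ̃ = Λ(σ̂), and for n ≥ 0 let σ̃_n be the solution of the single-step problem min{ λ_n‖Λ̃−Λ(σ)‖_H² + ‖σ‖_{H₁} : σ ∈ X } and let {σ_n} be the multiscale sequence with σ_{−1} = 0. Then for every n ≥ 0: ‖σ̂ − σ̃_n‖_{H₁} ≤ ‖σ̂‖_{H₁}, ‖Λ(σ̂ − σ̃_n)‖_H² ≤ ‖σ̂‖_{H₁}/λ_n, ‖σ̂ − σ_n‖_{H₁} ≤ ‖σ̂ − σ_{n−1}‖_{H₁} ≤ ‖σ̂‖_{H₁}, and ‖Λ(σ̂ − σ_n)‖_H² ≤ ‖σ̂ − σ_n‖_{H₁}/λ_n. -/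
open Filter Finset
open scoped ENNReal Topology

theorem inner_nonneg_of_norm_le_norm_add_smul_s12 {E : Type*} [NormedAddCommGroup E]
    [InnerProductSpace ℝ E] {x y : E}
    (h : ∀ s : ℝ, 0 < s → s ≤ 1 → ‖x‖ ≤ ‖x + s • y‖) : 0 ≤ inner ℝ x y := by
  by_contra! hp
  set p : ℝ := inner ℝ x y with hpdef
  have hq : 0 < ‖y‖ ^ 2 - p := by nlinarith [sq_nonneg ‖y‖]
  obtain ⟨s, hs⟩ : ∃ s : ℝ, s = -p / (‖y‖ ^ 2 - p) := ⟨_, rfl⟩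
  have hs0 : 0 < s := hs ▸ div_pos (neg_pos.mpr hp) hq
  have hs1 : s ≤ 1 := by
    rw [hs, div_le_one hq]
    nlinarith [sq_nonneg ‖y‖]
  have hsq : s * (‖y‖ ^ 2 - p) = -p := by rw [hs, div_mul_cancel₀ _ hq.ne']
  have h1 : ‖x‖ ^ 2 ≤ ‖x + s • y‖ ^ 2 := pow_le_pow_left₀ (norm_nonneg _) (h s hs0 hs1) 2
  rw [norm_add_sq_real, inner_smul_right, norm_smul, mul_pow, Real.norm_eq_abs, sq_abs,
    ← hpdef] at h1
  have h2 : 0 ≤ s * (p + s * p) := by nlinarith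
  nlinarith [mul_pos hs0 hs0]

/-- Noiseless regularization by the norm: the residual of a minimizer is no larger than the
target, and it bounds the data misfit. -/
theorem norm_sub_le_and_misfit_le_of_minimizer {E F : Type*} [NormedAddCommGroup E]
    [InnerProductSpace ℝ E] [NormedAddCommGroup F] [NormedSpace ℝ F]
    (A : E →ₗ[ℝ] F) {c : ℝ} (hc : 0 ≤ c) {x t : E}
    (h : ∀ v : E, c * ‖A (x - t)‖ ^ 2 + ‖t‖ ≤ c * ‖A (x - v)‖ ^ 2 + ‖v‖) :
    ‖x - t‖ ≤ ‖x‖ ∧ c * ‖A (x - t)‖ ^ 2 ≤ ‖x - t‖ := by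
  constructor
  · have hin : 0 ≤ inner ℝ t (x - t) := by
      refine inner_nonneg_of_norm_le_norm_add_smul_s12 fun s hs0 hs1 => ?_
      have hA : x - (t + s • (x - t)) = (1 - s) • (x - t) := by module
      have hle : ‖A (x - (t + s • (x - t)))‖ ≤ ‖A (x - t)‖ := by
        rw [hA, map_smul, norm_smul, Real.norm_eq_abs, abs_of_nonneg (by linarith)]
        exact mul_le_of_le_one_left (norm_nonneg _) (by linarith)
      have hc' := mul_le_mul_of_nonneg_left (pow_le_pow_left₀ (norm_nonneg _) hle 2) hc
      linarith [h (t + s • (x - t))]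
    have hx : ‖x‖ ^ 2 = ‖t + (x - t)‖ ^ 2 := by rw [add_sub_cancel]
    rw [norm_add_sq_real] at hx
    exact le_of_sq_le_sq (by nlinarith [sq_nonneg ‖t‖]) (norm_nonneg _)
  · have hx := h x
    rw [sub_self, map_zero, norm_zero] at hx
    linarith [norm_sub_norm_le x t]

/-- stability comparison, Section 3.2.
With `Λ̃ = Λ σ̂`, `σ̂ = ι ŵ ∈ H₁`, the single-step solutions `σ̃_n = ι (t n)` of
`min λ_n‖Λ̃ − Λ σ‖² + ‖σ‖_{H₁}` and the multiscale iterates `σ_n = ∑_{j≤n} ι (w j)`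
satisfy, for every `n ≥ 0`:
`‖σ̂ − σ̃_n‖_{H₁} ≤ ‖σ̂‖_{H₁}`, `‖Λ(σ̂ − σ̃_n)‖² ≤ ‖σ̂‖_{H₁}/λ_n`,
`‖σ̂ − σ_n‖_{H₁} ≤ ‖σ̂ − σ_{n−1}‖_{H₁} ≤ ‖σ̂‖_{H₁}` and
`‖Λ(σ̂ − σ_n)‖² ≤ ‖σ̂ − σ_n‖_{H₁}/λ_n`. -/
theorem statement12
    {X H H1 : Type*} [NormedAddCommGroup X] [NormedSpace ℝ X] [CompleteSpace X]
    [NormedAddCommGroup H] [InnerProductSpace ℝ H] [CompleteSpace H]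
    [NormedAddCommGroup H1] [InnerProductSpace ℝ H1] [CompleteSpace H1]
    (ι : H1 →ₗ[ℝ] X) (hι : Function.Injective ι)
    (Λ : X →L[ℝ] H)
    (hΛinj : ∀ v v' : H1, Λ (ι v) = Λ (ι v') → v = v')
    (R : X → ℝ≥0∞)
    (hR1 : ∀ w : H1, R (ι w) = ENNReal.ofReal ‖w‖)
    (hR2 : ∀ u : X, u ∉ Set.range ι → R u = ⊤)
    (hcomp : ∀ b : ℝ, IsCompact (closure {u : X | R u ≤ ENNReal.ofReal b}))
    (hlsc : LowerSemicontinuous R)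
    (lam : ℕ → ℝ) (hlampos : ∀ n, 0 < lam n) (hlammono : StrictMono lam)
    (hlamtop : Tendsto lam atTop atTop)
    (what : H1)
    (t : ℕ → H1)
    (ht : ∀ n : ℕ, ∀ v : X,
      ENNReal.ofReal (lam n * ‖Λ (ι what) - Λ (ι (t n))‖ ^ 2) + R (ι (t n)) ≤
        ENNReal.ofReal (lam n * ‖Λ (ι what) - Λ v‖ ^ 2) + R v)
    (u : ℕ → X) (w : ℕ → H1) (hw : ∀ n, u n = ι (w n))
    (hmin : ∀ n : ℕ, ∀ v : X,
      ENNReal.ofReal (lam n *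
          ‖Λ (ι what) - Λ ((∑ j ∈ Finset.range n, u j) + u n)‖ ^ 2) + R (u n) ≤
        ENNReal.ofReal (lam n *
          ‖Λ (ι what) - Λ ((∑ j ∈ Finset.range n, u j) + v)‖ ^ 2) + R v) :
    ∀ n : ℕ,
      ‖what - t n‖ ≤ ‖what‖ ∧
      ‖Λ (ι what) - Λ (ι (t n))‖ ^ 2 ≤ ‖what‖ / lam n ∧
      ‖what - ∑ j ∈ Finset.range (n + 1), w j‖ ≤ ‖what - ∑ j ∈ Finset.range n, w j‖ ∧
      ‖what - ∑ j ∈ Finset.range n, w j‖ ≤ ‖what‖ ∧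
      ‖Λ (ι what) - Λ (∑ j ∈ Finset.range (n + 1), u j)‖ ^ 2 ≤
        ‖what - ∑ j ∈ Finset.range (n + 1), w j‖ / lam n := by
  have toReal : ∀ {a b r s : ℝ}, 0 ≤ a → 0 ≤ b → 0 ≤ r → 0 ≤ s →
      ENNReal.ofReal a + ENNReal.ofReal r ≤ ENNReal.ofReal b + ENNReal.ofReal s →
      a + r ≤ b + s := by
    intro a b r s ha hb hr hs h
    rw [← ENNReal.ofReal_add ha hr, ← ENNReal.ofReal_add hb hs] at h
    exact (ENNReal.ofReal_le_ofReal_iff (add_nonneg hb hs)).mp h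
  have misfit_nonneg : ∀ n (y : H), 0 ≤ lam n * ‖y‖ ^ 2 := fun n y =>
    mul_nonneg (hlampos n).le (sq_nonneg _)
  let A : H1 →ₗ[ℝ] H := (Λ : X →ₗ[ℝ] H) ∘ₗ ι
  have hA : ∀ x y : H1, A (x - y) = Λ (ι x) - Λ (ι y) := fun x y => by simp [A]
  have hu : ∀ n, ∑ j ∈ Finset.range n, u j = ι (∑ j ∈ Finset.range n, w j) := fun n => by
    simp [hw]
  have single : ∀ n, ‖what - t n‖ ≤ ‖what‖ ∧ lam n * ‖A (what - t n)‖ ^ 2 ≤ ‖what - t n‖ := by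
    intro n
    refine norm_sub_le_and_misfit_le_of_minimizer A (hlampos n).le fun v => ?_
    have h := ht n (ι v)
    rw [hR1, hR1, ← hA, ← hA] at h
    exact toReal (misfit_nonneg _ _) (misfit_nonneg _ _) (norm_nonneg _) (norm_nonneg _) h
  have multi : ∀ n,
      ‖what - ∑ j ∈ Finset.range (n + 1), w j‖ ≤ ‖what - ∑ j ∈ Finset.range n, w j‖ ∧
      lam n * ‖A (what - ∑ j ∈ Finset.range (n + 1), w j)‖ ^ 2 ≤
        ‖what - ∑ j ∈ Finset.range (n + 1), w j‖ := by
    intro n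
    rw [Finset.sum_range_succ, ← sub_sub]
    refine norm_sub_le_and_misfit_le_of_minimizer A (hlampos n).le fun v => ?_
    have h := hmin n (ι v)
    rw [hw n, hR1, hR1, hu, ← map_add ι, ← map_add ι, ← hA, ← hA, ← sub_sub, ← sub_sub] at h
    exact toReal (misfit_nonneg _ _) (misfit_nonneg _ _) (norm_nonneg _) (norm_nonneg _) h
  have residual_le : ∀ n, ‖what - ∑ j ∈ Finset.range n, w j‖ ≤ ‖what‖ := by
    intro n
    induction n with
    | zero => simp
    | succ k ih => exact (multi k).1.trans ih
  intro n
  refine ⟨(single n).1, ?_, (multi n).1, residual_le n, ?_⟩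
  · rw [le_div_iff₀' (hlampos n), ← hA]
    exact (single n).2.trans (single n).1
  · rw [le_div_iff₀' (hlampos n), hu, ← hA]
    exact (multi n).2
end

section
/- The operator Λ : ℓ¹ → ℓ² defined by Λ(γ) = Σ_{j≥1} γ_j Λ(e_j), where Λ(e_j) = (j/b)[ Σ_{i=1}^k A_i η_{j+i−2} e_{j+i−2} + μ_{j+k−2} e_{j+k−2} − μ_{j+k−1} e_{j+k−1} ] for j ≥ 2 and Λ(e_1) = Σ_{m=1}^k C_m η_m e_m + Σ_{m≥k+1} η_m e_m + μ_k e_k, is a bounded linear operator from ℓ¹ into ℓ², and Λ is injective on ℓ¹ (hence in particular on F). -/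
open Filter Finset
open scoped ENNReal Topology

noncomputable section

/-- `A_i`, `i = 1, …, k`: `A_1 = 1 − kδ`, `A_i = δ` for `2 ≤ i ≤ k−1`, `A_k = 2δ`. -/
def Acoef (k : ℕ) (δ : ℝ) (i : ℕ) : ℝ :=
  if i = 1 then 1 - k * δ else if i = k then 2 * δ else δ

/-- `C_m = ∑_{i=1}^m A_i`. -/
def Ccoef (k : ℕ) (δ : ℝ) (m : ℕ) : ℝ := ∑ i ∈ Finset.Icc 1 m, Acoef k δ i

/-- `η_j = √(c₀ / M^j)` (paper index `j ≥ 1`). -/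
def eta (c0 M : ℝ) (j : ℕ) : ℝ := Real.sqrt (c0 / M ^ j)

/-- `μ_j = −δ η_j`. -/
def mu (c0 M δ : ℝ) (j : ℕ) : ℝ := -δ * eta c0 M j

/-- The `m`-th coordinate (paper index `m ≥ 1`) of `Λ e_j` (paper index `j ≥ 1`):
for `j ≥ 2`,
`Λ e_j = (j/b) [ ∑_{i=1}^k A_i η_{j+i−2} e_{j+i−2} + μ_{j+k−2} e_{j+k−2} − μ_{j+k−1} e_{j+k−1} ]`,
and `Λ e_1 = ∑_{m=1}^k C_m η_m e_m + ∑_{m≥k+1} η_m e_m + μ_k e_k`. -/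
def lamCoord (c0 M δ b : ℝ) (k j m : ℕ) : ℝ :=
  if j = 1 then
    (if 1 ≤ m ∧ m ≤ k then Ccoef k δ m * eta c0 M m
      else if k + 1 ≤ m then eta c0 M m else 0) +
      (if m = k then mu c0 M δ k else 0)
  else
    ((j : ℝ) / b) *
      ((if j - 1 ≤ m ∧ m ≤ j + k - 2 then Acoef k δ (m + 2 - j) * eta c0 M m else 0) +
        (if m = j + k - 2 then mu c0 M δ m else 0) -
        (if m = j + k - 1 then mu c0 M δ m else 0))

/-- `Λ : ℓ¹ → ℓ²` realizes the matrix `lamCoord` on the standard unit vectors, where the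
Lean index `j : ℕ` corresponds to the paper index `j + 1`. -/
def lpSpec (c0 M δ b : ℝ) (k : ℕ)
    (Λ : lp (fun _ : ℕ => ℝ) 1 →L[ℝ] lp (fun _ : ℕ => ℝ) 2) : Prop :=
  ∀ j m : ℕ, (Λ (lp.single 1 j 1)) m = lamCoord c0 M δ b k (j + 1) (m + 1)

/-- The Toeplitz symbol of `Λ`, indexed from `0`: the entries of the `A_i` merged with those of
the `μ` terms. -/
def toeplitzCoef (k : ℕ) (δ : ℝ) (i : ℕ) : ℝ :=
  if i = 0 then 1 - k * δ else if i ≤ k then δ else 0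

theorem sum_range_toeplitzCoef (k : ℕ) (δ : ℝ) (m : ℕ) :
    ∑ i ∈ range (m + 1), toeplitzCoef k δ i = 1 - k * δ + (min m k : ℕ) * δ := by
  induction m with
  | zero => simp [toeplitzCoef]
  | succ m ih =>
    rw [sum_range_succ, ih, toeplitzCoef, if_neg (Nat.succ_ne_zero m)]
    split_ifs with h
    · rw [min_eq_left h, min_eq_left (by omega)]
      push_cast
      ring
    · rw [min_eq_right (by omega), min_eq_right (by omega), add_zero]

theorem Ccoef_succ_of_lt (k : ℕ) (δ : ℝ) (m : ℕ) (h : m + 1 < k) :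
    Ccoef k δ (m + 1) = 1 - k * δ + m * δ := by
  induction m with
  | zero => simp [Ccoef, Acoef]
  | succ m ih =>
    have ih := ih (by omega)
    rw [Ccoef] at ih ⊢
    rw [sum_Icc_succ_top (by omega), ih, Acoef, if_neg (by omega), if_neg (by omega)]
    push_cast
    ring

theorem Ccoef_self (k : ℕ) (δ : ℝ) (hk : 2 ≤ k) : Ccoef k δ k = 1 := by
  obtain ⟨n, rfl⟩ : ∃ n, k = n + 2 := ⟨k - 2, by omega⟩
  have h := Ccoef_succ_of_lt (n + 2) δ n (by omega)
  rw [Ccoef] at h ⊢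
  rw [sum_Icc_succ_top (by omega), h, Acoef, if_neg (by omega), if_pos rfl]
  push_cast
  ring

theorem lamCoord_one (c0 M δ b : ℝ) (k m : ℕ) (hk : 2 ≤ k) :
    lamCoord c0 M δ b k 1 (m + 1) =
      eta c0 M (m + 1) * ∑ i ∈ range (m + 1), toeplitzCoef k δ i := by
  rw [sum_range_toeplitzCoef, lamCoord, if_pos rfl]
  rcases lt_trichotomy (m + 1) k with h | h | h
  · rw [if_pos ⟨by omega, h.le⟩, if_neg h.ne, Ccoef_succ_of_lt k δ m h, min_eq_left (by omega)]
    ring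
  · subst h
    rw [if_pos ⟨by omega, le_rfl⟩, if_pos rfl, Ccoef_self _ δ hk, min_eq_left (by omega), mu]
    push_cast
    ring
  · rw [if_neg (by omega), if_pos (by omega), if_neg (by omega), min_eq_right (by omega)]
    ring

theorem lamCoord_add_two (c0 M δ b : ℝ) (k p m : ℕ) (hk : 2 ≤ k) :
    lamCoord c0 M δ b k (p + 2) (m + 1) =
      if p ≤ m then ((p + 2 : ℕ) : ℝ) / b * (eta c0 M (m + 1) * toeplitzCoef k δ (m - p))
      else 0 := by
  rw [lamCoord, if_neg (by omega)]
  split_ifs with h₁ h₂ h₃ h₄ <;> try omega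
  all_goals try simp only [mu, Acoef, toeplitzCoef]
  all_goals try split_ifs
  all_goals try omega
  all_goals ring

theorem eta_nonneg (c0 M : ℝ) (m : ℕ) : 0 ≤ eta c0 M m := Real.sqrt_nonneg _

theorem eta_pos {c0 M : ℝ} (hc0 : 0 < c0) (hM : 0 < M) (m : ℕ) : 0 < eta c0 M m :=
  Real.sqrt_pos.2 (by positivity)

theorem abs_toeplitzCoef_le_one {k : ℕ} {δ : ℝ} (hk : 1 ≤ k) (hδ0 : 0 ≤ δ) (hkδ : k * δ ≤ 1)
    (i : ℕ) : |toeplitzCoef k δ i| ≤ 1 := by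
  have h1 : (1 : ℝ) ≤ k := by exact_mod_cast hk
  rw [toeplitzCoef, abs_le]
  split_ifs <;> constructor <;> nlinarith

/-- All the columns of the matrix are dominated by one square summable sequence. -/
theorem abs_lamCoord_le {c0 M δ b : ℝ} {k : ℕ} (hk : 2 ≤ k) (hb : 0 < b) (hδ0 : 0 ≤ δ)
    (hkδ : k * δ ≤ 1) (j m : ℕ) :
    |lamCoord c0 M δ b k (j + 1) (m + 1)| ≤ (1 + 1 / b) * ((m + 2) * eta c0 M (m + 1)) := by
  have hη := eta_nonneg c0 M (m + 1)
  have hm : (0 : ℝ) ≤ m := m.cast_nonneg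
  have hb' : 0 < 1 / b := by positivity
  rcases j with _ | p
  · have hmin : ((min m k : ℕ) : ℝ) ≤ k := by exact_mod_cast min_le_right m k
    have hmin0 : (0 : ℝ) ≤ (min m k : ℕ) := Nat.cast_nonneg _
    have hs : |∑ i ∈ range (m + 1), toeplitzCoef k δ i| ≤ 1 := by
      rw [sum_range_toeplitzCoef, abs_le]
      constructor <;> nlinarith
    rw [zero_add, lamCoord_one _ _ _ _ _ _ hk, abs_mul, abs_of_nonneg hη]
    calc eta c0 M (m + 1) * |∑ i ∈ range (m + 1), toeplitzCoef k δ i|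
        ≤ eta c0 M (m + 1) * 1 := by gcongr
      _ ≤ (m + 2) * eta c0 M (m + 1) := by nlinarith
      _ ≤ (1 + 1 / b) * ((m + 2) * eta c0 M (m + 1)) :=
          le_mul_of_one_le_left (by positivity) (by linarith)
  · rw [lamCoord_add_two _ _ _ _ _ _ _ hk]
    split_ifs with h
    · have hp : ((p + 2 : ℕ) : ℝ) ≤ m + 2 := by exact_mod_cast (by omega : p + 2 ≤ m + 2)
      have ht := abs_toeplitzCoef_le_one (by omega : 1 ≤ k) hδ0 hkδ (m - p)
      rw [abs_mul, abs_mul, abs_of_nonneg hη, abs_of_nonneg (by positivity)]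
      calc ((p + 2 : ℕ) : ℝ) / b * (eta c0 M (m + 1) * |toeplitzCoef k δ (m - p)|)
          ≤ (m + 2) / b * (eta c0 M (m + 1) * 1) := by gcongr
        _ = 1 / b * ((m + 2) * eta c0 M (m + 1)) := by ring
        _ ≤ (1 + 1 / b) * ((m + 2) * eta c0 M (m + 1)) := by gcongr; linarith
    · rw [abs_zero]
      positivity

theorem memℓp_mul_eta {c0 M : ℝ} (hc0 : 0 ≤ c0) (hM : 1 < M) (K : ℝ) :
    Memℓp (fun m : ℕ => K * ((m + 2) * eta c0 M (m + 1))) 2 := by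
  refine memℓp_gen ?_
  have hr : ‖M⁻¹‖ < 1 := by
    rw [Real.norm_of_nonneg (by positivity)]
    exact inv_lt_one_of_one_lt₀ hM
  have h := ((((summable_pow_mul_geometric_of_norm_lt_one 2 hr).add
    ((summable_pow_mul_geometric_of_norm_lt_one 1 hr).mul_left 4)).add
    ((summable_geometric_of_norm_lt_one hr).mul_left 4))).mul_left (K ^ 2 * c0 * M⁻¹)
  refine h.congr fun m => ?_
  have hη : eta c0 M (m + 1) ^ 2 = c0 / M ^ (m + 1) := Real.sq_sqrt (by positivity)
  simp only [ENNReal.toReal_ofNat, Real.rpow_ofNat, Real.norm_eq_abs, sq_abs, mul_pow, hη, inv_pow]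
  field_simp
  ring

/-- A bounded sequence `c` in a Banach space is the image of the unit vectors under a bounded
operator on `ℓ¹`. -/
theorem exists_clm_lp_one_single {E : Type*} [NormedAddCommGroup E] [NormedSpace ℝ E]
    [CompleteSpace E] (c : ℕ → E) (K : ℝ) (hc : ∀ j, ‖c j‖ ≤ K) :
    ∃ Λ : lp (fun _ : ℕ => ℝ) 1 →L[ℝ] E, ∀ j, Λ (lp.single 1 j 1) = c j := by
  have hγ (γ : lp (fun _ : ℕ => ℝ) 1) : HasSum (fun j => ‖γ j‖) ‖γ‖ := by
    simpa using lp.hasSum_norm (p := 1) (by simp) γ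
  have hle (γ : lp (fun _ : ℕ => ℝ) 1) (j : ℕ) : ‖γ j • c j‖ ≤ ‖γ j‖ * K := by
    rw [norm_smul]
    exact mul_le_mul_of_nonneg_left (hc j) (norm_nonneg _)
  have hsum (γ : lp (fun _ : ℕ => ℝ) 1) : Summable fun j => γ j • c j :=
    Summable.of_norm_bounded ((hγ γ).summable.mul_right K) (hle γ)
  refine ⟨LinearMap.mkContinuous
    { toFun := fun γ => ∑' j, γ j • c j
      map_add' := fun x y => ?_
      map_smul' := fun a x => ?_ } K fun γ => ?_, fun j => ?_⟩
  · rw [← (hsum x).tsum_add (hsum y)]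
    simp [add_smul]
  · rw [RingHom.id_apply, ← (hsum x).tsum_const_smul]
    simp [mul_smul]
  · rw [mul_comm]
    exact tsum_of_norm_bounded ((hγ γ).mul_right K) (hle γ)
  · change ∑' i, (lp.single 1 j (1 : ℝ) : lp (fun _ : ℕ => ℝ) 1) i • c i = c j
    rw [tsum_eq_single j fun i hi => by simp [lp.single_apply, hi]]
    simp

theorem eq_zero_of_toeplitz {β y : ℕ → ℝ} (hβ : β 0 ≠ 0)
    (h : ∀ m, ∑ p ∈ range (m + 1), β (m - p) * y p = 0) (m : ℕ) : y m = 0 := by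
  induction m using Nat.strong_induction_on with
  | _ m ih =>
    have hm := h m
    rw [sum_range_succ, sum_eq_zero fun p hp => by rw [ih p (mem_range.1 hp), mul_zero]] at hm
    simpa [hβ] using hm

theorem hasSum_clm_lp_one_apply (Λ : lp (fun _ : ℕ => ℝ) 1 →L[ℝ] lp (fun _ : ℕ => ℝ) 2)
    (γ : lp (fun _ : ℕ => ℝ) 1) (m : ℕ) :
    HasSum (fun j => γ j * (Λ (lp.single 1 j 1)) m) ((Λ γ) m) := by
  have hs (j : ℕ) : (Λ (lp.single 1 j (γ j))) m = γ j * (Λ (lp.single 1 j 1)) m := by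
    rw [← mul_one (γ j), ← smul_eq_mul, lp.single_smul, map_smul, lp.coeFn_smul, Pi.smul_apply]
    simp
  have h : HasSum (fun j => (Λ (lp.single 1 j (γ j))) m) ((Λ γ) m) :=
    (lp.hasSum_single ENNReal.one_ne_top γ).mapL ((lp.evalCLM ℝ (fun _ : ℕ => ℝ) 2 m).comp Λ)
  simpa only [hs] using h

/-- Dividing by `η` and eliminating the invertible Toeplitz factor, the kernel condition becomes
`jγ_j = −bγ_1` for `j ≥ 2`. -/
theorem coeff_eq_of_map_eq_zero {M c0 b δ : ℝ} {k : ℕ} (hM : 0 < M) (hk : 2 ≤ k) (hc0 : 0 < c0)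
    (hkδ : k * δ < 1) {Λ : lp (fun _ : ℕ => ℝ) 1 →L[ℝ] lp (fun _ : ℕ => ℝ) 2}
    (hΛ : lpSpec c0 M δ b k Λ) {γ : lp (fun _ : ℕ => ℝ) 1} (hγ : Λ γ = 0) (p : ℕ) :
    γ (p + 1) * (((p + 2 : ℕ) : ℝ) / b) + γ 0 = 0 := by
  refine eq_zero_of_toeplitz (β := toeplitzCoef k δ)
    (y := fun p => γ (p + 1) * (((p + 2 : ℕ) : ℝ) / b) + γ 0) ?_ (fun m => ?_) p
  · rw [toeplitzCoef, if_pos rfl]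
    linarith
  have hη := (eta_pos hc0 hM (m + 1)).ne'
  have hsum := hasSum_clm_lp_one_apply Λ γ m
  simp only [hΛ _ m, hγ] at hsum
  have hfin := hasSum_sum_of_ne_finset_zero (L := .unconditional ℕ) (s := range (m + 2))
    (f := fun j => γ j * lamCoord c0 M δ b k (j + 1) (m + 1)) fun j hj => by
      obtain ⟨p, rfl⟩ : ∃ p, j = p + 1 := ⟨j - 1, by simp at hj; omega⟩
      rw [lamCoord_add_two _ _ _ _ _ _ _ hk, if_neg (by simp at hj; omega), mul_zero]
  have heq := hfin.unique hsum
  rw [sum_range_succ', zero_add, lamCoord_one _ _ _ _ _ _ hk,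
    ← sum_range_reflect (toeplitzCoef k δ)] at heq
  refine (mul_eq_zero.1 ?_).resolve_left hη
  refine Eq.trans ?_ heq
  rw [mul_sum, mul_sum, mul_sum, ← sum_add_distrib]
  refine sum_congr rfl fun p hp => ?_
  rw [lamCoord_add_two _ _ _ _ _ _ _ hk, if_pos (by simp at hp; omega),
    show m + 1 - 1 - p = m - p by omega]
  ring

/-- Lemma 4.1.  The operator `Λ` defined by the coefficients above is
a well-defined bounded linear operator from `ℓ¹` into `ℓ²`, and it is injective on `ℓ¹`
(hence in particular on `F`). -/
theorem statement13 (M α0 c0 b δ : ℝ) (k : ℕ) (hM : 2 ≤ M) (hα0 : 0 < α0)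
    (hk : 3 ≤ k) (hc0 : 0 < c0) (hb : 0 < b) (hδ0 : 0 < δ) (hδ1 : δ < 1 / k) :
    (∃ Λ : lp (fun _ : ℕ => ℝ) 1 →L[ℝ] lp (fun _ : ℕ => ℝ) 2, lpSpec c0 M δ b k Λ) ∧
    ∀ Λ : lp (fun _ : ℕ => ℝ) 1 →L[ℝ] lp (fun _ : ℕ => ℝ) 2,
      lpSpec c0 M δ b k Λ → Function.Injective Λ := by
  have hkpos : (0 : ℝ) < k := by exact_mod_cast (by omega : 0 < k)
  have hkδ : k * δ < 1 := by rwa [mul_comm, ← lt_div_iff₀ hkpos]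
  have hk2 : 2 ≤ k := by omega
  refine ⟨?_, fun Λ hΛ => (injective_iff_map_eq_zero Λ).2 fun γ hγ => ?_⟩
  · have hg := memℓp_mul_eta hc0.le (by linarith : 1 < M) (1 + 1 / b)
    have hle (j m : ℕ) := abs_lamCoord_le (c0 := c0) (M := M) hk2 hb hδ0.le hkδ.le j m
    have hmem (j : ℕ) : Memℓp (fun m => lamCoord c0 M δ b k (j + 1) (m + 1)) 2 :=
      hg.mono (hle j)
    obtain ⟨Λ, hΛ⟩ := exists_clm_lp_one_single
      (fun j => (⟨_, hmem j⟩ : lp (fun _ : ℕ => ℝ) 2)) ‖(⟨_, hg⟩ : lp (fun _ : ℕ => ℝ) 2)‖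
      fun j => lp.norm_mono (by simp) fun m => (hle j m).trans (le_abs_self _)
    exact ⟨Λ, fun j m => by rw [hΛ j]⟩
  · have hrec := coeff_eq_of_map_eq_zero (by linarith) hk2 hc0 hkδ hΛ hγ
    have hγp (p : ℕ) : γ (p + 1) = -(b * γ 0) * ((p + 2 : ℕ) : ℝ)⁻¹ := by
      have h := hrec p
      field_simp at h ⊢
      linarith
    have hsum : Summable fun j => γ j := (lp.hasSum_norm (p := 1) (by simp) γ).summable.congr
      (fun j => by simp) |>.of_norm
    have h0 : γ 0 = 0 := by
      by_contra hne
      have hs := (summable_nat_add_iff 1).2 hsum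
      simp only [hγp] at hs
      rw [summable_mul_left_iff (by simp [hb.ne', hne]),
        summable_nat_add_iff (f := fun n : ℕ => (n : ℝ)⁻¹) 2] at hs
      exact Real.not_summable_natCast_inv hs
    ext j
    rcases j with _ | p
    · simpa using h0
    · simpa [h0] using hγp p
end
end
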